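/- For all sufficiently large n, the number D(n) of isomorphism classes of connected distance-hereditary simple graphs on n vertices satisfies 7.249^n ≤ D(n) ≤ 7.2498^n. -/

import Mathlib

/-- A simple graph is distance-hereditary if in every connected induced subgraph,
distances agree with those in the ambient graph. -/
def DistanceHereditary {V : Type} (G : SimpleGraph V) : Prop :=
  ∀ S : Set V, (G.induce S).Connected →
    ∀ u v : S, (G.induce S).dist u v = G.dist u.val v.val

/-- The number of isomorphism classes of connected distance-hereditary simple graphs
on `n` vertices. -/
noncomputable def numConnDH (n : ℕ) : ℕ :=
  Nat.card (Quot (fun (G G' : {G : SimpleGraph (Fin n) // G.Connected ∧ DistanceHereditary G}) =>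
    Nonempty (G.val ≃g G'.val)))

namespace DistHered

/-- `Reach G S n x y` says that `G` has a walk of length at most `n` from `x` to `y`
inside `S`. -/
inductive Reach {V : Type} (G : SimpleGraph V) (S : Set V) : ℕ → V → V → Prop
  | refl {n : ℕ} {x : V} : x ∈ S → Reach G S n x x
  | step {n : ℕ} {x y z : V} : x ∈ S → G.Adj x y → Reach G S n y z → Reach G S (n + 1) x z

/-- Any two vertices of `S` are joined by a walk inside `S`. -/
def Conn {V : Type} (G : SimpleGraph V) (S : Set V) : Prop :=
  ∀ x ∈ S, ∀ y ∈ S, ∃ n, Reach G S n x y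

/-- The subgraph of `G` induced on `S` is distance-hereditary. -/
def DHOn {V : Type} (G : SimpleGraph V) (S : Set V) : Prop :=
  ∀ T ⊆ S, Conn G T → ∀ x ∈ T, ∀ y ∈ T, ∀ n, Reach G S n x y → Reach G T n x y

section Reach

variable {V : Type} {G : SimpleGraph V} {S T : Set V} {m n : ℕ} {x y z : V}

theorem Reach.left_mem (h : Reach G S n x y) : x ∈ S := by
  cases h <;> assumption

theorem Reach.right_mem (h : Reach G S n x y) : y ∈ S := by
  induction h <;> assumption

theorem Reach.mono_set (hST : S ⊆ T) (h : Reach G S n x y) : Reach G T n x y := by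
  induction h with
  | refl hx => exact .refl (hST hx)
  | step hx ha _ ih => exact .step (hST hx) ha ih

theorem Reach.mono (h : Reach G S n x y) (hmn : n ≤ m) : Reach G S m x y := by
  induction h generalizing m with
  | refl hx => exact .refl hx
  | step hx ha _ ih =>
    obtain ⟨m, rfl⟩ : ∃ k, m = k + 1 := ⟨m - 1, by omega⟩
    exact .step hx ha (ih (by omega))

theorem Reach.trans (h : Reach G S n x y) (h' : Reach G S m y z) : Reach G S (n + m) x z := by
  induction h with
  | refl hx => exact h'.mono (by omega)
  | @step k _ _ _ hx ha _ ih => exact (Reach.step hx ha (ih h')).mono (by omega)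

theorem Reach.of_adj (hx : x ∈ S) (hy : y ∈ S) (h : G.Adj x y) : Reach G S 1 x y :=
  .step hx h (.refl hy)

theorem Reach.symm (h : Reach G S n x y) : Reach G S n y x := by
  induction h with
  | refl hx => exact .refl hx
  | step hx ha h ih => exact ih.trans (.of_adj h.left_mem hx ha.symm)

theorem Reach.map {f : V → V} (hf : ∀ x ∈ S, f x ∈ T)
    (hadj : ∀ x ∈ S, ∀ y ∈ S, G.Adj x y → G.Adj (f x) (f y) ∨ f x = f y)
    (h : Reach G S n x y) : Reach G T n (f x) (f y) := by
  induction h with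
  | refl hx => exact .refl (hf _ hx)
  | step hx ha h ih =>
    rcases hadj _ hx _ h.left_mem ha with h1 | h1
    · exact .step (hf _ hx) h1 ih
    · rw [h1]; exact ih.mono (by omega)

theorem Reach.exists_walk (h : Reach G S n x y) :
    ∃ p : (G.induce S).Walk ⟨x, h.left_mem⟩ ⟨y, h.right_mem⟩, p.length ≤ n := by
  induction h with
  | refl hx => exact ⟨.nil, by simp⟩
  | step hx ha h ih =>
    obtain ⟨p, hp⟩ := ih
    refine ⟨.cons (v := ⟨_, h.left_mem⟩) (by simpa using ha) p, by simpa using hp⟩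

theorem Reach.of_walk {u v : S} (p : (G.induce S).Walk u v) :
    Reach G S p.length u.1 v.1 := by
  induction p with
  | nil => exact .refl (Subtype.prop _)
  | cons h p ih => exact .step (Subtype.prop _) (by simpa using h) ih

theorem Reach.of_univ_walk {u v : V} (p : G.Walk u v) : Reach G Set.univ p.length u v := by
  induction p with
  | nil => exact .refl trivial
  | cons h p ih => exact .step trivial h ih

theorem Reach.exists_univ_walk (h : Reach G S n x y) : ∃ p : G.Walk x y, p.length ≤ n := by
  induction h with
  | refl hx => exact ⟨.nil, by simp⟩
  | step hx ha h ih =>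
    obtain ⟨p, hp⟩ := ih
    exact ⟨.cons ha p, by simpa using hp⟩

theorem conn_iff_preconnected : Conn G S ↔ (G.induce S).Preconnected := by
  constructor
  · intro h u v
    obtain ⟨n, hn⟩ := h u.1 u.2 v.1 v.2
    obtain ⟨p, -⟩ := hn.exists_walk
    exact ⟨p⟩
  · intro h x hx y hy
    obtain ⟨p⟩ := h ⟨x, hx⟩ ⟨y, hy⟩
    exact ⟨_, Reach.of_walk p⟩

theorem conn_univ_iff : Conn G Set.univ ↔ G.Preconnected := by
  constructor
  · intro h u v
    obtain ⟨n, hn⟩ := h u trivial v trivial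
    obtain ⟨p, -⟩ := hn.exists_univ_walk
    exact ⟨p⟩
  · intro h x _ y _
    obtain ⟨p⟩ := h x y
    exact ⟨_, Reach.of_univ_walk p⟩

theorem distanceHereditary_iff : DistanceHereditary G ↔ DHOn G Set.univ := by
  constructor
  · intro h T _ hT x hx y hy n hn
    have hc : (G.induce T).Connected :=
      { preconnected := conn_iff_preconnected.1 hT, nonempty := ⟨⟨x, hx⟩⟩ }
    have h1 := h T hc ⟨x, hx⟩ ⟨y, hy⟩
    obtain ⟨p, hp⟩ := hn.exists_univ_walk
    obtain ⟨q, hq⟩ := hc.exists_walk_length_eq_dist ⟨x, hx⟩ ⟨y, hy⟩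
    have h2 := G.dist_le p
    exact (Reach.of_walk q).mono (by simp only at h1; omega)
  · intro h S hS u v
    obtain ⟨q, hq⟩ := hS.exists_walk_length_eq_dist u v
    obtain ⟨q', hq'⟩ := (Reach.of_walk q).exists_univ_walk
    obtain ⟨p, hp⟩ := SimpleGraph.Reachable.exists_walk_length_eq_dist (G := G) ⟨q'⟩
    have h1 := h S (Set.subset_univ _) (conn_iff_preconnected.2 hS.preconnected) u.1 u.2 v.1 v.2 _
      (Reach.of_univ_walk p)
    obtain ⟨r, hr⟩ := h1.exists_walk
    have h2 := (G.induce S).dist_le r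
    have h3 := G.dist_le q'
    exact le_antisymm (by simp only [Subtype.coe_eta] at h2; omega) (by omega)

theorem DHOn.mono (h : DHOn G S) (hTS : T ⊆ S) : DHOn G T :=
  fun U hU hc x hx y hy n hn => h U (hU.trans hTS) hc x hx y hy n (hn.mono_set hTS)

end Reach

end DistHered

namespace DistHered

section Cograph

variable {V : Type}

/-- `G` has no induced path on four vertices inside `W`. -/
def P4Free (G : SimpleGraph V) (W : Finset V) : Prop :=
  ∀ a ∈ W, ∀ b ∈ W, ∀ c ∈ W, ∀ d ∈ W, G.Adj a b → G.Adj b c → G.Adj c d →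
    G.Adj a c ∨ G.Adj b d ∨ G.Adj a d

theorem P4Free.mono {G : SimpleGraph V} {W W' : Finset V} (h : P4Free G W) (hW : W' ⊆ W) :
    P4Free G W' :=
  fun a ha b hb c hc d hd => h a (hW ha) b (hW hb) c (hW hc) d (hW hd)

theorem P4Free.compl {G : SimpleGraph V} {W : Finset V} (h : P4Free G W) : P4Free Gᶜ W := by
  intro a ha b hb c hc d hd hab hbc hcd
  have h1 := h b hb d hd a ha c hc
  simp only [SimpleGraph.compl_adj] at *
  have := G.adj_comm
  grind

/-- `p` splits `W` into two nonempty parts without edges between them. -/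
def Splits (G : SimpleGraph V) (W : Finset V) (p : V → Prop) : Prop :=
  (∃ x ∈ W, p x) ∧ (∃ x ∈ W, ¬ p x) ∧ ∀ x ∈ W, ∀ y ∈ W, p x → ¬ p y → ¬ G.Adj x y

theorem exists_splits_insert [DecidableEq V] {G : SimpleGraph V} {W : Finset V} {v : V}
    {p : V → Prop}
    (hv : v ∉ W) (h : P4Free G (insert v W)) (hp : Splits G W p) :
    ∃ q, Splits G (insert v W) q ∨ Splits Gᶜ (insert v W) q := by
  have hcomm := G.adj_comm
  by_cases hall : ∀ u ∈ W, G.Adj v u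
  · refine ⟨fun x => x = v, Or.inr ?_⟩
    obtain ⟨⟨x, hx, hpx⟩, -, -⟩ := hp
    refine ⟨⟨v, by simp, rfl⟩, ⟨x, by simp [hx], by grind⟩, ?_⟩
    intro a _ b hb ha hb'
    simp only [SimpleGraph.compl_adj]
    grind
  · push Not at hall
    obtain ⟨u, hu, huv⟩ := hall
    obtain ⟨p, hp, hpu⟩ : ∃ p, Splits G W p ∧ p u := by
      by_cases hpu : p u
      · exact ⟨p, hp, hpu⟩
      · refine ⟨fun x => ¬ p x, ⟨hp.2.1, ?_, ?_⟩, hpu⟩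
        · simpa using hp.1
        · have := hp.2.2
          grind
    obtain ⟨-, ⟨y, hy, hpy⟩, hno⟩ := hp
    by_cases hB : ∃ c ∈ W, ¬ p c ∧ G.Adj c v
    · obtain ⟨c, hc, hpc, hcv⟩ := hB
      refine ⟨fun x => x ∈ W ∧ p x ∧ ¬ G.Adj x v, Or.inl ⟨⟨u, by simp [hu], by grind⟩,
        ⟨v, by simp, by grind⟩, ?_⟩⟩
      intro a ha b hb hpa hpb hab
      have h4 := h c (by simp [hc]) v (by simp) b hb a ha hcv
      grind
    · refine ⟨fun x => x = v ∨ p x,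
        Or.inl ⟨⟨v, by simp, by grind⟩, ⟨y, by simp [hy], by grind⟩, ?_⟩⟩
      intro a ha b hb hpa hpb hab
      grind

/-- Seinsche's theorem. -/
theorem P4Free.exists_splits [DecidableEq V] {G : SimpleGraph V} {W : Finset V}
    (h : P4Free G W) (hW : 2 ≤ W.card) : ∃ q, Splits G W q ∨ Splits Gᶜ W q := by
  induction W using Finset.induction_on with
  | empty => simp at hW
  | insert v W hv ih =>
    rw [Finset.card_insert_of_notMem hv] at hW
    rcases Nat.lt_or_ge W.card 2 with h2 | h2
    · obtain ⟨w, rfl⟩ : ∃ w, W = {w} := Finset.card_eq_one.1 (by omega)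
      have hne : v ≠ w := by simpa using hv
      refine ⟨fun x => x = v, ?_⟩
      by_cases hvw : G.Adj v w
      · refine Or.inr ⟨⟨v, by simp⟩, ⟨w, by simp [hne.symm]⟩, ?_⟩
        intro a _ b hb ha hb'
        simp only [SimpleGraph.compl_adj]
        grind
      · refine Or.inl ⟨⟨v, by simp⟩, ⟨w, by simp [hne.symm]⟩, ?_⟩
        intro a _ b hb ha hb'
        grind
    · obtain ⟨q, hq | hq⟩ := ih (h.mono (Finset.subset_insert _ _)) h2
      · exact exists_splits_insert hv h hq
      · obtain ⟨q, hq⟩ := exists_splits_insert hv h.compl hq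
        rw [compl_compl] at hq
        exact ⟨q, hq.symm⟩

/-- `x` and `y` have the same neighbours in `W`, apart from themselves. -/
def Twins (G : SimpleGraph V) (W : Set V) (x y : V) : Prop :=
  ∀ c ∈ W, c ≠ x → c ≠ y → (G.Adj c x ↔ G.Adj c y)

theorem twins_compl {G : SimpleGraph V} {W : Set V} {x y : V} (h : Twins Gᶜ W x y) :
    Twins G W x y := by
  intro c hc hx hy
  have := h c hc hx hy
  simp only [SimpleGraph.compl_adj] at this
  grind

theorem P4Free.exists_twins {G : SimpleGraph V} {W : Finset V}
    (h : P4Free G W) (hW : 2 ≤ W.card) : ∃ x ∈ W, ∃ y ∈ W, x ≠ y ∧ Twins G W x y := by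
  classical
  induction W using Finset.strongInduction generalizing G with
  | H W ih =>
    obtain ⟨q, hq⟩ := h.exists_splits hW
    wlog hs : Splits G W q generalizing G
    · have hq' : Splits Gᶜ W q := by tauto
      obtain ⟨x, hx, y, hy, hne, ht⟩ := this h.compl (by rw [compl_compl]; tauto) hq'
      exact ⟨x, hx, y, hy, hne, twins_compl ht⟩
    have hcomm := G.adj_comm
    obtain ⟨⟨a, ha, hpa⟩, ⟨b, hb, hpb⟩, hno⟩ := hs
    have key : ∀ p : V → Prop, (∃ x ∈ W, ¬ p x) →
        (∀ x ∈ W, ∀ y ∈ W, p x → ¬ p y → ¬ G.Adj x y) → 2 ≤ (W.filter p).card →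
        ∃ x ∈ W, ∃ y ∈ W, x ≠ y ∧ Twins G W x y := by
      intro p hpe hno h2
      obtain ⟨x, hx, y, hy, hne, ht⟩ := ih (W.filter p) (Finset.filter_ssubset.2 hpe)
        (h.mono (Finset.filter_subset _ _)) h2
      rw [Finset.mem_filter] at hx hy
      refine ⟨x, hx.1, y, hy.1, hne, fun c hc hcx hcy => ?_⟩
      by_cases hpc : p c
      · exact ht c (by simpa using ⟨hc, hpc⟩) hcx hcy
      · have h1 := hno x hx.1 c hc hx.2 hpc
        have h2 := hno y hy.1 c hc hy.2 hpc
        grind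
    by_cases h1 : 2 ≤ (W.filter q).card
    · exact key q ⟨b, hb, hpb⟩ hno h1
    by_cases h2 : 2 ≤ (W.filter (fun x => ¬ q x)).card
    · exact key (fun x => ¬ q x) ⟨a, ha, by simpa using hpa⟩ (by grind) (by convert h2)
    · refine ⟨a, ha, b, hb, by grind, fun c hc hca hcb => ?_⟩
      exfalso
      rw [Finset.mem_coe] at hc
      by_cases hqc : q c
      · exact h1 (Finset.one_lt_card.2 ⟨a, by simp [*], c, by simp [*], hca.symm⟩)
      · exact h2 (Finset.one_lt_card.2 ⟨b, by simp [*], c, by simp [*], hcb.symm⟩)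

end Cograph

end DistHered

namespace DistHered

section Levels

variable {V : Type} {G : SimpleGraph V} {S T : Set V} {r x y z : V}

theorem Conn.insert_adj (hT : Conn G T) (hy : y ∈ T) (h : G.Adj x y) : Conn G (insert x T) := by
  have hx : ∀ z ∈ T, ∃ n, Reach G (Insert.insert x T) n x z := by
    intro z hz
    obtain ⟨n, hn⟩ := hT y hy z hz
    exact ⟨_, .step (by simp) h (hn.mono_set (Set.subset_insert _ _))⟩
  rintro a (rfl | ha) b (rfl | hb)
  · exact ⟨0, .refl (by simp)⟩
  · exact hx b hb
  · obtain ⟨n, hn⟩ := hx a ha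
    exact ⟨n, hn.symm⟩
  · obtain ⟨n, hn⟩ := hT a ha b hb
    exact ⟨n, hn.mono_set (Set.subset_insert _ _)⟩

theorem conn_singleton (x : V) : Conn G {x} := by
  rintro a rfl b rfl
  exact ⟨0, .refl rfl⟩

/-- Distance from `r` inside `S`. -/
noncomputable def lev (G : SimpleGraph V) (S : Set V) (r x : V) : ℕ :=
  sInf {n | Reach G S n x r}

theorem Reach.lev_le {n : ℕ} (h : Reach G S n x r) : lev G S r x ≤ n :=
  Nat.sInf_le h

theorem Conn.reach_lev (hS : Conn G S) (hr : r ∈ S) (hx : x ∈ S) :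
    Reach G S (lev G S r x) x r :=
  Nat.sInf_mem (s := {n | Reach G S n x r}) (hS x hx r hr)

theorem lev_self (hr : r ∈ S) : lev G S r r = 0 :=
  Nat.le_zero.1 (Reach.refl hr).lev_le

theorem Conn.eq_of_lev (hS : Conn G S) (hr : r ∈ S) (hx : x ∈ S) (h : lev G S r x = 0) : x = r := by
  have h1 := hS.reach_lev hr hx
  rw [h] at h1
  cases h1
  rfl

theorem Conn.lev_le_succ (hS : Conn G S) (hr : r ∈ S) (hx : x ∈ S) (hy : y ∈ S) (h : G.Adj x y) :
    lev G S r x ≤ lev G S r y + 1 :=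
  (Reach.step hx h (hS.reach_lev hr hy)).lev_le

/-- In a distance-hereditary graph every connected set containing the root contains, with
each vertex, a neighbour of that vertex that is closer to the root. -/
theorem DHOn.exists_parent (hd : DHOn G S) (hS : Conn G S) (hTS : T ⊆ S) (hT : Conn G T)
    (hr : r ∈ T) (hy : y ∈ T) {n : ℕ} (hn : lev G S r y = n + 1) :
    ∃ z ∈ T, G.Adj y z ∧ lev G S r z = n := by
  have h := hS.reach_lev (hTS hr) (hTS hy)
  rw [hn] at h
  have h' := hd T hTS hT y hy r hr _ h
  cases h' with
  | refl _ => rw [lev_self (hTS hr)] at hn; omega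
  | step _ ha h1 =>
    refine ⟨_, h1.left_mem, ha, ?_⟩
    have h2 := (h1.mono_set hTS).lev_le
    have h3 := hS.lev_le_succ (hTS hr) (hTS hy) (hTS h1.left_mem) ha
    omega

theorem Conn.exists_geodesic (hd : DHOn G S) (hS : Conn G S) (hr : r ∈ S) (hx : x ∈ S) :
    ∃ Q ⊆ S, Conn G Q ∧ x ∈ Q ∧ r ∈ Q ∧
      ∀ q ∈ Q, lev G S r q ≤ lev G S r x ∧ (lev G S r q = lev G S r x → q = x) := by
  induction hn : lev G S r x generalizing x with
  | zero =>
    obtain rfl := hS.eq_of_lev hr hx hn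
    exact ⟨{x}, by simpa using hx, conn_singleton x, by simp, by simp, by simp [hn]⟩
  | succ n ih =>
    obtain ⟨y, hy, hxy, hyn⟩ := hd.exists_parent hS subset_rfl hS hr hx hn
    obtain ⟨Q, hQS, hQ, hyQ, hrQ, hq⟩ := ih hy hyn
    refine ⟨insert x Q, Set.insert_subset hx hQS, hQ.insert_adj hyQ hxy, by simp, by simp [hrQ], ?_⟩
    rintro q (rfl | hqQ)
    · simp [hn]
    · have := hq q hqQ
      omega

theorem DHOn.adj_parent (hd : DHOn G S) (hS : Conn G S) (hr : r ∈ S) (hx : x ∈ S) (hy : y ∈ S)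
    (hz : z ∈ S) {n : ℕ} (hxn : lev G S r x = n + 1) (hyn : lev G S r y = n + 1)
    (hzn : lev G S r z = n) (hxy : G.Adj x y) (hxz : G.Adj x z) : G.Adj y z := by
  obtain ⟨Q, hQS, hQ, hzQ, hrQ, hq⟩ := hS.exists_geodesic hd hr hz
  obtain ⟨w, hw, hyw, hwn⟩ := hd.exists_parent hS (T := insert y (insert x Q)) (r := r) (y := y)
    (Set.insert_subset hy (Set.insert_subset hx hQS))
    ((hQ.insert_adj hzQ hxz).insert_adj (by simp) hxy.symm)
    (by simp [hrQ]) (by simp) hyn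
  rcases hw with rfl | rfl | hw
  · omega
  · omega
  · obtain rfl := (hq w hw).2 (by omega)
    exact hyw

theorem DHOn.adj_grandparent (hd : DHOn G S) (hS : Conn G S) (hr : r ∈ S) {a b c : V}
    (hx : x ∈ S) (ha : a ∈ S) (hb : b ∈ S) (hc : c ∈ S) {n : ℕ} (hxn : lev G S r x = n + 2)
    (han : lev G S r a = n + 1) (hbn : lev G S r b = n + 1) (hcn : lev G S r c = n)
    (hxa : G.Adj x a) (hxb : G.Adj x b) (hac : G.Adj a c) : G.Adj b c := by
  obtain ⟨Q, hQS, hQ, hcQ, hrQ, hq⟩ := hS.exists_geodesic hd hr hc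
  obtain ⟨w, hw, hbw, hwn⟩ := hd.exists_parent hS (T := insert b (insert x (insert a Q)))
    (r := r) (y := b)
    (Set.insert_subset hb (Set.insert_subset hx (Set.insert_subset ha hQS)))
    (((hQ.insert_adj hcQ hac).insert_adj (by simp) hxa).insert_adj (by simp) hxb.symm)
    (by simp [hrQ]) (by simp) hbn
  rcases hw with rfl | rfl | rfl | hw
  · omega
  · omega
  · omega
  · obtain rfl := (hq w hw).2 (by omega)
    exact hbw

theorem Reach.of_two {a d : V} (h : Reach G T 2 a d) :
    a = d ∨ G.Adj a d ∨ ∃ y ∈ T, G.Adj a y ∧ G.Adj y d := by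
  cases h with
  | refl => exact Or.inl rfl
  | step ha hab h =>
    cases h with
    | refl => exact Or.inr (Or.inl hab)
    | step hb hbc h =>
      cases h
      exact Or.inr (Or.inr ⟨_, hb, hab, hbc⟩)

/-- An induced path on four vertices whose ends have a common neighbour. -/
theorem DHOn.no_path_four (hd : DHOn G S) {a b c d w : V} (ha : a ∈ S) (hb : b ∈ S) (hc : c ∈ S)
    (hd' : d ∈ S) (hw : w ∈ S) (hab : G.Adj a b) (hbc : G.Adj b c) (hcd : G.Adj c d)
    (haw : G.Adj a w) (hwd : G.Adj w d) : G.Adj a c ∨ G.Adj b d ∨ G.Adj a d := by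
  have hT : Conn G {a, b, c, d} :=
    (((conn_singleton d).insert_adj (by simp) hcd).insert_adj (by simp) hbc).insert_adj
      (by simp) hab
  have h := (hd {a, b, c, d} (by grind) hT a (by simp) d (by simp) 2
    (.step ha haw (.step hw hwd (.refl hd')))).of_two
  have := G.adj_comm
  have := fun v => G.irrefl (v := v)
  rcases h with rfl | h | ⟨y, hy, h1, h2⟩
  · exact Or.inl hcd.symm
  · exact Or.inr (Or.inr h)
  · rcases hy with rfl | rfl | rfl | rfl <;> grind

/-- An induced path on five vertices whose ends have a common neighbour. -/
theorem DHOn.no_path_five (hd : DHOn G S) {a b c d e w : V} (ha : a ∈ S) (hb : b ∈ S) (hc : c ∈ S)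
    (hd' : d ∈ S) (he : e ∈ S) (hw : w ∈ S) (hab : G.Adj a b) (hbc : G.Adj b c) (hcd : G.Adj c d)
    (hde : G.Adj d e) (haw : G.Adj a w) (hwe : G.Adj w e) :
    a = e ∨ G.Adj a e ∨ G.Adj b e ∨ (G.Adj a c ∧ G.Adj c e) ∨ G.Adj a d := by
  have hT : Conn G {a, b, c, d, e} :=
    ((((conn_singleton e).insert_adj (by simp) hde).insert_adj (by simp) hcd).insert_adj
      (by simp) hbc).insert_adj (by simp) hab
  have h := (hd {a, b, c, d, e} (by grind) hT a (by simp) e (by simp) 2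
    (.step ha haw (.step hw hwe (.refl he)))).of_two
  have := G.adj_comm
  have := fun v => G.irrefl (v := v)
  rcases h with rfl | h | ⟨y, hy, h1, h2⟩
  · exact Or.inl rfl
  · exact Or.inr (Or.inl h)
  · rcases hy with rfl | rfl | rfl | rfl | rfl <;> grind

theorem DHOn.p4Free (hd : DHOn G S) {W : Finset V} {w : V} (hw : w ∈ S) (hWS : ∀ x ∈ W, x ∈ S)
    (h : ∀ x ∈ W, G.Adj x w) : P4Free G W :=
  fun a ha b hb c hc d hd' hab hbc hcd =>
    hd.no_path_four (hWS a ha) (hWS b hb) (hWS c hc) (hWS d hd') hw hab hbc hcd (h a ha)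
      (h d hd').symm

end Levels

end DistHered

namespace DistHered

section Prune

variable {V : Type} {G : SimpleGraph V} {S : Set V} {r : V}

theorem DHOn.adj_of_reach_level (hd : DHOn G S) (hS : Conn G S) (hr : r ∈ S) {k n : ℕ} {a b z : V}
    (hz : z ∈ S) (hzk : lev G S r z = k)
    (h : Reach G {c | c ∈ S ∧ lev G S r c = k + 1} n a b) (ha : G.Adj a z) : G.Adj b z := by
  induction h with
  | refl _ => exact ha
  | step hx hxy h ih =>
    exact ih (hd.adj_parent hS hr hx.1 h.left_mem.1 hz hx.2 h.left_mem.2 hzk hxy ha)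

theorem DHOn.exists_twins_of_edge [Finite V] (hd : DHOn G S) (hS : Conn G S) (hr : r ∈ S) {k : ℕ}
    (hmax : ∀ c ∈ S, lev G S r c ≤ k + 1) {x y : V} (hx : x ∈ S) (hy : y ∈ S)
    (hxk : lev G S r x = k + 1) (hyk : lev G S r y = k + 1) (hxy : G.Adj x y) :
    ∃ u ∈ S, ∃ w ∈ S, u ≠ w ∧ u ≠ r ∧ w ≠ r ∧ Twins G S u w := by
  classical
  have := Fintype.ofFinite V
  obtain ⟨z, hz, hxz, hzk⟩ := hd.exists_parent hS subset_rfl hS hr hx hxk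
  set L : Set V := {c | c ∈ S ∧ lev G S r c = k + 1} with hL
  set R : Finset V := Finset.univ.filter (fun c => ∃ n, Reach G L n x c) with hR
  have hRL : ∀ c ∈ R, c ∈ L := by
    intro c hc
    obtain ⟨n, hn⟩ := (Finset.mem_filter.1 hc).2
    exact hn.right_mem
  have hRz : ∀ c ∈ R, ∀ z ∈ S, lev G S r z = k → (G.Adj c z ↔ G.Adj x z) := by
    intro c hc z hz hzk
    obtain ⟨n, hn⟩ := (Finset.mem_filter.1 hc).2
    exact ⟨hd.adj_of_reach_level hS hr hz hzk hn.symm, hd.adj_of_reach_level hS hr hz hzk hn⟩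
  have hxR : x ∈ R := by simpa [hR] using ⟨0, .refl ⟨hx, hxk⟩⟩
  have hyR : y ∈ R := by simpa [hR] using ⟨1, .of_adj ⟨hx, hxk⟩ ⟨hy, hyk⟩ hxy⟩
  have hp4 : P4Free G R := hd.p4Free hz (fun c hc => (hRL c hc).1)
    (fun c hc => (hRz c hc z hz hzk).2 hxz)
  obtain ⟨u, hu, w, hw, huw, ht⟩ := hp4.exists_twins
    (Finset.one_lt_card.2 ⟨x, hxR, y, hyR, hxy.ne⟩)
  have hner : ∀ c ∈ R, c ≠ r := by
    rintro c hc rfl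
    have := (hRL c hc).2
    rw [lev_self hr] at this
    omega
  have key : ∀ u ∈ R, ∀ w ∈ R, ∀ c ∈ S, c ∉ R → G.Adj c u → G.Adj c w := by
    intro u hu w hw c hc hcR hcu
    have h1 := hS.lev_le_succ hr (hRL u hu).1 hc hcu.symm
    rw [(hRL u hu).2] at h1
    rcases (hmax c hc).lt_or_eq with h2 | h2
    · have h3 : lev G S r c = k := by omega
      exact ((hRz w hw c hc h3).2 ((hRz u hu c hc h3).1 hcu.symm)).symm
    · exfalso
      obtain ⟨n, hn⟩ := (Finset.mem_filter.1 hu).2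
      exact hcR (by simpa [hR] using ⟨_, hn.trans (.of_adj (hRL u hu) ⟨hc, h2⟩ hcu.symm)⟩)
  refine ⟨u, (hRL u hu).1, w, (hRL w hw).1, huw, hner u hu, hner w hw, fun c hc hcu hcw => ?_⟩
  by_cases hcR : c ∈ R
  · exact ht c hcR hcu hcw
  · exact ⟨key u hu w hw c hc hcR, key w hw u hu c hc hcR⟩

theorem DHOn.exists_twins_or_pendant_of_indep [Finite V] (hd : DHOn G S) (hS : Conn G S)
    (hr : r ∈ S)
    {k : ℕ} (hmax : ∀ c ∈ S, lev G S r c ≤ k + 2) {x0 : V} (hx0 : x0 ∈ S)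
    (hx0k : lev G S r x0 = k + 2)
    (hind : ∀ x ∈ S, ∀ y ∈ S, lev G S r x = k + 2 → lev G S r y = k + 2 → ¬ G.Adj x y) :
    ∃ u ∈ S, ∃ w ∈ S, u ≠ w ∧ u ≠ r ∧ w ≠ r ∧ (Twins G S u w ∨ ∀ c ∈ S, G.Adj c w ↔ c = u) := by
  classical
  have := Fintype.ofFinite V
  have hcomm := G.adj_comm
  set N : V → Finset V := fun x => Finset.univ.filter (fun a => a ∈ S ∧ G.Adj x a) with hN
  have hmemN : ∀ x a, a ∈ N x ↔ a ∈ S ∧ G.Adj x a := by simp [hN]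
  obtain ⟨x, ⟨hx, hxk⟩, hmin⟩ := Set.exists_min_image {x | x ∈ S ∧ lev G S r x = k + 2}
    (fun x => (N x).card) (Set.toFinite _) ⟨x0, hx0, hx0k⟩
  have hNlev : ∀ x ∈ S, lev G S r x = k + 2 → ∀ a ∈ N x, lev G S r a = k + 1 := by
    intro x hx hxk a ha
    rw [hmemN] at ha
    have h1 := hS.lev_le_succ hr hx ha.1 ha.2
    have h2 := hmax a ha.1
    have h3 : lev G S r a ≠ k + 2 := fun h => hind x hx a ha.1 hxk h ha.2
    omega
  have hner : ∀ c, lev G S r c ≠ 0 → c ≠ r := by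
    rintro c hc rfl
    exact hc (lev_self hr)
  obtain ⟨z, hz, hxz, -⟩ := hd.exists_parent hS subset_rfl hS hr hx hxk
  have hzN : z ∈ N x := (hmemN _ _).2 ⟨hz, hxz⟩
  rcases Nat.lt_or_ge (N x).card 2 with hcard | hcard
  · refine ⟨z, hz, x, hx, hxz.ne', hner _ ?_, hner _ ?_, Or.inr fun c hc => ⟨fun h => ?_, ?_⟩⟩
    · rw [hNlev x hx hxk z hzN]; omega
    · omega
    · by_contra hcz
      exact absurd (Finset.one_lt_card.2 ⟨c, (hmemN _ _).2 ⟨hc, h.symm⟩, z, hzN, hcz⟩) (by omega)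
    · rintro rfl; exact hxz.symm
  have hgp : ∀ x ∈ S, lev G S r x = k + 2 → ∀ a ∈ N x, ∀ b ∈ N x, ∀ c ∈ S, lev G S r c = k →
      G.Adj a c → G.Adj b c := by
    intro x hx hxk a ha b hb c hc hck hac
    have ha' := (hmemN _ _).1 ha
    have hb' := (hmemN _ _).1 hb
    exact hd.adj_grandparent hS hr hx ha'.1 hb'.1 hc hxk (hNlev x hx hxk a ha)
      (hNlev x hx hxk b hb) hck ha'.2 hb'.2 hac
  have hside : ∀ x ∈ S, lev G S r x = k + 2 → ∀ a ∈ N x, ∀ b ∈ N x, ∀ c ∈ S, lev G S r c = k + 1 →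
      c ∉ N x → G.Adj c a → G.Adj c b := by
    intro x hx hxk a ha b hb c hc hck hcN hca
    have hak := hNlev x hx hxk a ha
    have hxc : ¬ G.Adj x c := fun h => hcN ((hmemN _ _).2 ⟨hc, h⟩)
    have ha' := (hmemN _ _).1 ha
    have hb' := (hmemN _ _).1 hb
    obtain ⟨d, hdS, had, hdk⟩ := hd.exists_parent hS subset_rfl hS hr ha'.1 hak
    have hbd := hgp x hx hxk a ha b hb d hdS hdk had
    have hcd := hd.adj_parent hS hr ha'.1 hc hdS hak hck hdk hca.symm had
    have hxd : ¬ G.Adj x d := fun h => by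
      have := hNlev x hx hxk d ((hmemN _ _).2 ⟨hdS, h⟩)
      omega
    by_contra hcb
    by_cases hab : G.Adj a b
    · have := hd.no_path_four hx hb'.1 hdS hc ha'.1 hb'.2 hbd hcd.symm ha'.2 hca.symm
      grind
    · have := hd.no_path_four hc ha'.1 hx hb'.1 hdS hca ha'.2.symm hb'.2 hcd hbd.symm
      grind
  have hp4 : P4Free G (N x) := hd.p4Free hx (fun c hc => ((hmemN _ _).1 hc).1)
    (fun c hc => ((hmemN _ _).1 hc).2.symm)
  obtain ⟨a, ha, b, hb, hab, ht⟩ := hp4.exists_twins hcard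
  have key : ∀ a ∈ N x, ∀ b ∈ N x, Twins G (N x) a b → ∀ c ∈ S, c ∉ N x → G.Adj c a →
      G.Adj c b := by
    intro a ha b hb ht c hc hcN hca
    have ha' := (hmemN _ _).1 ha
    have hb' := (hmemN _ _).1 hb
    have hak := hNlev x hx hxk a ha
    have hbk := hNlev x hx hxk b hb
    have h1 := hS.lev_le_succ hr ha'.1 hc hca.symm
    have h2 := hmax c hc
    obtain h3 | h3 | h3 : lev G S r c = k ∨ lev G S r c = k + 1 ∨ lev G S r c = k + 2 := by omega
    · exact (hgp x hx hxk a ha b hb c hc h3 hca.symm).symm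
    · exact hside x hx hxk a ha b hb c hc h3 hcN hca
    · by_contra hcb
      have haNc : a ∈ N c := (hmemN _ _).2 ⟨ha'.1, hca⟩
      have hbNc : b ∉ N c := fun h => hcb ((hmemN _ _).1 h).2
      obtain ⟨e, heNc, heNx⟩ : ∃ e ∈ N c, e ∉ N x := by
        by_contra hno
        push Not at hno
        have := Finset.card_lt_card (Finset.ssubset_iff_subset_ne.2
          ⟨hno, fun h => hbNc (h ▸ hb)⟩)
        have := hmin c ⟨hc, h3⟩
        omega
      have he' := (hmemN _ _).1 heNc
      have hek := hNlev c hc h3 e heNc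
      have hxe : ¬ G.Adj x e := fun h => heNx ((hmemN _ _).2 ⟨he'.1, h⟩)
      have hxc : ¬ G.Adj x c := hind x hx c hc hxk h3
      obtain ⟨d, hdS, had, hdk⟩ := hd.exists_parent hS subset_rfl hS hr ha'.1 hak
      have hbd := hgp x hx hxk a ha b hb d hdS hdk had
      have hed := hgp c hc h3 a haNc e heNc d hdS hdk had
      have hbe : b ≠ e := by rintro rfl; exact hbNc heNc
      have e1 := hside x hx hxk a ha b hb e he'.1 hek heNx
      have e2 := hside x hx hxk b hb a ha e he'.1 hek heNx
      have e3 := hside c hc h3 a haNc e heNc b hb'.1 hbk hbNc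
      have e4 := hside c hc h3 e heNc a haNc b hb'.1 hbk hbNc
      by_cases hbe' : G.Adj b e
      · have := hd.no_path_four hx hb'.1 he'.1 hc ha'.1 hb'.2 hbe' he'.2.symm ha'.2 hca.symm
        grind
      · have := hd.no_path_five hb'.1 hx ha'.1 hc he'.1 hdS hb'.2.symm ha'.2 hca.symm he'.2 hbd
          hed.symm
        grind
  refine ⟨a, ((hmemN _ _).1 ha).1, b, ((hmemN _ _).1 hb).1, hab, hner _ ?_, hner _ ?_,
    Or.inl fun c hc hca hcb => ?_⟩
  · rw [hNlev x hx hxk a ha]; omega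
  · rw [hNlev x hx hxk b hb]; omega
  · by_cases hcN : c ∈ N x
    · exact ht c hcN hca hcb
    · exact ⟨key a ha b hb ht c hc hcN,
        key b hb a ha (fun c hc h1 h2 => (ht c hc h2 h1).symm) c hc hcN⟩

/-- Bandelt and Mulder: a connected distance-hereditary graph with a root and at least two further
vertices has a pair of twins, or a pendant vertex and its neighbour, avoiding the root. -/
theorem DHOn.exists_twins_or_pendant [Finite V] (hd : DHOn G S) (hS : Conn G S) (hr : r ∈ S)
    {p q : V} (hp : p ∈ S) (hq : q ∈ S) (hpq : p ≠ q) (hpr : p ≠ r) (hqr : q ≠ r) :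
    ∃ u ∈ S, ∃ w ∈ S, u ≠ w ∧ u ≠ r ∧ w ≠ r ∧ (Twins G S u w ∨ ∀ c ∈ S, G.Adj c w ↔ c = u) := by
  obtain ⟨x0, hx0, hmax⟩ := Set.exists_max_image S (lev G S r) (Set.toFinite _) ⟨r, hr⟩
  have hpos : ∀ c ∈ S, c ≠ r → lev G S r c ≠ 0 := fun c hc hcr h => hcr (hS.eq_of_lev hr hc h)
  obtain ⟨k, hk⟩ : ∃ k, lev G S r x0 = k + 1 :=
    ⟨lev G S r x0 - 1, by have := hpos p hp hpr; have := hmax p hp; omega⟩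
  rw [hk] at hmax
  by_cases hE : ∃ x ∈ S, ∃ y ∈ S, lev G S r x = k + 1 ∧ lev G S r y = k + 1 ∧ G.Adj x y
  · obtain ⟨x, hx, y, hy, hxk, hyk, hxy⟩ := hE
    obtain ⟨u, hu, w, hw, h1, h2, h3, h4⟩ := hd.exists_twins_of_edge hS hr hmax hx hy hxk hyk hxy
    exact ⟨u, hu, w, hw, h1, h2, h3, Or.inl h4⟩
  · push Not at hE
    rcases k with - | k
    · refine ⟨p, hp, q, hq, hpq, hpr, hqr, Or.inl fun c hc hcp hcq => ?_⟩
      have h1 : ∀ c ∈ S, c ≠ r → lev G S r c = 1 := fun c hc hcr => by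
        have := hpos c hc hcr
        have := hmax c hc
        omega
      by_cases hcr : c = r
      · have h2 : ∀ a ∈ S, a ≠ r → G.Adj r a := by
          intro a ha har
          obtain ⟨z, hz, haz, hz0⟩ := hd.exists_parent hS subset_rfl hS hr ha (h1 a ha har)
          obtain rfl := hS.eq_of_lev hr hz hz0
          exact haz.symm
        rw [hcr]
        exact iff_of_true (h2 p hp hpr) (h2 q hq hqr)
      · exact iff_of_false (hE c hc p hp (h1 c hc hcr) (h1 p hp hpr))
          (hE c hc q hq (h1 c hc hcr) (h1 q hq hqr))
    · exact hd.exists_twins_or_pendant_of_indep hS hr hmax hx0 hk hE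

end Prune

end DistHered

namespace DistHered

section Cherry

variable {V : Type} {G : SimpleGraph V} {S T : Set V} {u w x y : V} {tw : Prop} {n : ℕ}

/-- Inside `S`, the vertex `w` is a twin of `u` (if `tw` holds) or a pendant vertex attached
to `u` (if `tw` fails). -/
structure Cherry (G : SimpleGraph V) (S : Set V) (u w : V) (tw : Prop) : Prop where
  left_mem : u ∈ S
  right_mem : w ∈ S
  ne : u ≠ w
  adj_or : tw ∨ G.Adj u w
  adj_iff : ∀ c ∈ S, c ≠ u → c ≠ w → (G.Adj c w ↔ tw ∧ G.Adj c u)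

theorem Cherry.mono (h : Cherry G S u w tw) (hT : T ⊆ S) (hu : u ∈ T) (hw : w ∈ T) :
    Cherry G T u w tw :=
  ⟨hu, hw, h.ne, h.adj_or, fun c hc => h.adj_iff c (hT hc)⟩

open Classical in
theorem Cherry.retract (h : Cherry G S u w tw) (hr : Reach G S n x y) :
    Reach G (S \ {w}) n (if x = w then u else x) (if y = w then u else y) := by
  refine hr.map (f := fun z => if z = w then u else z) ?_ ?_
  · intro z hz
    by_cases hzw : z = w
    · simp [hzw, h.left_mem, h.ne]
    · simp [hzw, hz]
  · have key : ∀ c ∈ S, c ≠ w → G.Adj c w → G.Adj c u ∨ c = u := by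
      intro c hc hcw hadj
      by_cases hcu : c = u
      · exact .inr hcu
      · exact .inl ((h.adj_iff c hc hcu hcw).1 hadj).2
    intro a ha b hb hab
    by_cases haw : a = w
    · have hbw : b ≠ w := fun e => hab.ne (haw.trans e.symm)
      subst haw
      rcases key b hb hbw hab.symm with h1 | h1
      · simp [hbw, h1.symm]
      · simp [h1]
    · by_cases hbw : b = w
      · subst hbw
        simpa [haw] using key a ha haw hab
      · simp [haw, hbw, hab]

theorem Cherry.retract_of_ne (h : Cherry G S u w tw) (hx : x ≠ w) (hy : y ≠ w)
    (hr : Reach G S n x y) : Reach G (S \ {w}) n x y := by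
  simpa [hx, hy] using h.retract hr

theorem Cherry.conn_diff (h : Cherry G S u w tw) (hS : Conn G S) : Conn G (S \ {w}) := by
  rintro a ⟨ha, haw⟩ b ⟨hb, hbw⟩
  obtain ⟨n, hn⟩ := hS a ha b hb
  exact ⟨n, h.retract_of_ne haw hbw hn⟩

theorem Conn.exists_adj (hS : Conn G S) (hx : x ∈ S) (hy : y ∈ S) (hxy : x ≠ y) :
    ∃ c ∈ S, G.Adj x c := by
  obtain ⟨n, hn⟩ := hS x hx y hy
  cases hn with
  | refl => exact absurd rfl hxy
  | step _ ha h => exact ⟨_, h.left_mem, ha⟩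

theorem Cherry.conn (h : Cherry G S u w tw) (hS : Conn G (S \ {w})) {r : V} (hr : r ∈ S)
    (hru : r ≠ u) (hrw : r ≠ w) : Conn G S := by
  have hw : insert w (S \ {w}) = S := by
    rw [Set.insert_sdiff_singleton, Set.insert_eq_of_mem h.right_mem]
  rw [← hw]
  have hu : u ∈ S \ {w} := ⟨h.left_mem, h.ne⟩
  rcases h.adj_or with ht | ht
  · obtain ⟨c, hc, hac⟩ := hS.exists_adj hu ⟨hr, hrw⟩ hru.symm
    exact hS.insert_adj hc ((h.adj_iff c hc.1 hac.ne' hc.2).2 ⟨ht, hac.symm⟩).symm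
  · exact hS.insert_adj hu ht.symm

theorem Cherry.dhOn (h : Cherry G S u w tw) (hd : DHOn G (S \ {w})) : DHOn G S := by
  classical
  intro T hTS hT
  by_cases hwT : w ∈ T
  swap
  · intro x hx y hy n hn
    have hxw : x ≠ w := fun e => hwT (e ▸ hx)
    have hyw : y ≠ w := fun e => hwT (e ▸ hy)
    exact hd T (Set.subset_sdiff_singleton hTS hwT) hT x hx y hy n (h.retract_of_ne hxw hyw hn)
  by_cases huT : u ∈ T
  · have hc := h.mono hTS huT hwT
    have hT' := hc.conn_diff hT
    have hsub : T \ {w} ⊆ S \ {w} := Set.sdiff_subset_sdiff_left hTS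
    have hu : u ∈ T \ {w} := ⟨huT, h.ne⟩
    have key : ∀ y ∈ T, ∀ n, Reach G S n w y → Reach G T n w y := by
      intro y hy n hn
      by_cases hyw : y = w
      · subst hyw; exact .refl hy
      have hr := h.retract hn
      simp only [if_true, if_neg hyw] at hr
      by_cases hyu : y = u
      · subst hyu
        cases hn with
        | refl => exact absurd rfl h.ne
        | @step m _ c _ _ ha h' =>
          by_cases hau : G.Adj w y
          · exact (Reach.of_adj hwT huT hau).mono (by omega)
          · have htw := h.adj_or.resolve_right (fun e => hau e.symm)
            obtain ⟨c', hc', hac'⟩ := hT.exists_adj huT hwT h.ne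
            have hc'w : c' ≠ w := fun e => hau (e ▸ hac'.symm)
            have hm : 1 ≤ m := by
              cases h' with
              | refl => exact absurd ha hau
              | step => omega
            refine (Reach.step hwT ?_ (.of_adj hc' huT hac'.symm)).mono (by omega : 2 ≤ m + 1)
            exact ((h.adj_iff c' (hTS hc') hac'.ne' hc'w).2 ⟨htw, hac'.symm⟩).symm
      · by_cases htw : tw
        · have hr' := hd _ hsub hT' u hu y ⟨hy, hyw⟩ n hr
          cases hr' with
          | refl => exact absurd rfl hyu
          | @step m _ c _ _ ha h' =>
            have hcm := h'.left_mem
            refine .step hwT ?_ (h'.mono_set Set.sdiff_subset)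
            exact ((h.adj_iff c (hTS hcm.1) ha.ne' hcm.2).2 ⟨htw, ha.symm⟩).symm
        · cases hn with
          | refl => exact absurd rfl hyw
          | @step m _ c _ _ ha h' =>
            obtain rfl : c = u := by
              by_contra hcu
              exact htw ((h.adj_iff c h'.left_mem hcu ha.ne').1 ha.symm).1
            have h1 := h.retract h'
            simp only [if_neg h.ne, if_neg hyw] at h1
            exact .step hwT ha ((hd _ hsub hT' _ hu y ⟨hy, hyw⟩ m h1).mono_set Set.sdiff_subset)
    intro x hx y hy n hn
    by_cases hxw : x = w
    · subst hxw; exact key y hy n hn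
    by_cases hyw : y = w
    · subst hyw; exact (key x hx n hn.symm).symm
    exact (hd _ hsub hT' x ⟨hx, hxw⟩ y ⟨hy, hyw⟩ n (h.retract_of_ne hxw hyw hn)).mono_set
      Set.sdiff_subset
  · by_cases htw : tw
    · intro x hx y hy n hn
      have hxu : x ≠ u := fun e => huT (e ▸ hx)
      have hyu : y ≠ u := fun e => huT (e ▸ hy)
      have hcI : Cherry G (insert u T) u w tw :=
        h.mono (Set.insert_subset h.left_mem hTS) (by simp) (by simp [hwT])
      set T' := insert u T \ {w}
      have hT'S : T' ⊆ S \ {w} :=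
        Set.sdiff_subset_sdiff_left (Set.insert_subset h.left_mem hTS)
      have hret : ∀ {a b m}, Reach G T m a b →
          Reach G T' m (if a = w then u else a) (if b = w then u else b) :=
        fun hab => hcI.retract (hab.mono_set (Set.subset_insert _ _))
      have hback : ∀ {a b m}, Reach G T' m a b →
          Reach G T m (if a = u then w else a) (if b = u then w else b) := by
        intro a b m hab
        refine hab.map (f := fun z => if z = u then w else z) ?_ ?_
        · rintro z ⟨hz | hz, -⟩
          · simp [hz, hwT]
          · have : z ≠ u := fun e => huT (e ▸ hz)
            simp [this, hz]
        · intro a ha b hb he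
          by_cases hau : a = u
          · have hbu : b ≠ u := fun e => he.ne (hau.trans e.symm)
            subst hau
            simp only [if_true, if_neg hbu]
            exact .inl ((hcI.adj_iff b hb.1 hbu hb.2).2 ⟨htw, he.symm⟩).symm
          · by_cases hbu : b = u
            · subst hbu
              simp only [if_true, if_neg hau]
              exact .inl ((hcI.adj_iff a ha.1 hau ha.2).2 ⟨htw, he⟩)
            · simp [hau, hbu, he]
      have hT' : Conn G T' := by
        have hlift : ∀ a ∈ T', ∃ a' ∈ T, (if a' = w then u else a') = a := by
          rintro a ⟨ha | ha, haw⟩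
          · exact ⟨w, hwT, by simp [ha]⟩
          · exact ⟨a, ha, if_neg haw⟩
        intro a ha b hb
        obtain ⟨a', ha', rfl⟩ := hlift a ha
        obtain ⟨b', hb', rfl⟩ := hlift b hb
        obtain ⟨m, hm⟩ := hT a' ha' b' hb'
        exact ⟨m, hret hm⟩
      have hmem : ∀ a ∈ T, (if a = w then u else a) ∈ T' := fun a ha =>
        (hret (.refl (n := 0) ha)).left_mem
      have h1 := hback (hd T' hT'S hT' _ (hmem x hx) _ (hmem y hy) n (h.retract hn))
      have hinv : ∀ z ∈ T, (if (if z = w then u else z) = u then w else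
          (if z = w then u else z)) = z := by
        intro z hz
        have : z ≠ u := fun e => huT (e ▸ hz)
        by_cases hzw : z = w <;> simp [hzw, this]
      rwa [hinv x hx, hinv y hy] at h1
    · have hall : ∀ x ∈ T, x = w := by
        intro x hx
        by_contra hxw
        obtain ⟨c, hc, hac⟩ := hT.exists_adj hwT hx (fun e => hxw e.symm)
        exact htw ((h.adj_iff c (hTS hc) (fun e => huT (e ▸ hc)) hac.ne').1 hac.symm).1
      intro x hx y hy n _
      rw [hall x hx, hall y hy]
      exact .refl hwT

end Cherry

end DistHered

namespace DistHered

/-- The three ways of composing two graphs with marked vertices: disjoint union keeping both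
sets of marks, join of the marked sets keeping both sets of marks, and join of the marked sets
keeping only the marks of the left graph. -/
inductive Op
  | U
  | K
  | X

/-- `Dec G S M` says that the graph induced by `G` on `S`, with marked set `M`, can be built from
single marked vertices by means of the three composition operations. -/
inductive Dec {V : Type} (G : SimpleGraph V) : Set V → Set V → Prop
  | leaf (x : V) : Dec G {x} {x}
  | node {S₁ M₁ S₂ M₂ S M : Set V} (c : Op) (h₁ : Dec G S₁ M₁) (h₂ : Dec G S₂ M₂)
      (hd : Disjoint S₁ S₂)
      (hadj : ∀ x ∈ S₁, ∀ y ∈ S₂, G.Adj x y ↔ c ≠ Op.U ∧ x ∈ M₁ ∧ y ∈ M₂)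
      (hS : ∀ x, x ∈ S ↔ x ∈ S₁ ∨ x ∈ S₂) (hM : ∀ x, x ∈ M ↔ x ∈ M₁ ∨ c ≠ Op.X ∧ x ∈ M₂) :
      Dec G S M

section Dec

variable {V : Type} {G : SimpleGraph V} {S M : Set V}

theorem Dec.subset (h : Dec G S M) : M ⊆ S := by
  induction h with
  | leaf => rfl
  | node c _ _ _ _ hS hM ih₁ ih₂ =>
    intro x hx
    rcases (hM x).1 hx with h | h
    · exact (hS x).2 (.inl (ih₁ h))
    · exact (hS x).2 (.inr (ih₂ h.2))

theorem Dec.add_leaf (h : Dec G S M) {u w : V} {tw : Prop} (hu : u ∈ S) (hw : w ∉ S)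
    (htw : tw ∨ G.Adj u w) (hadj : ∀ c ∈ S, c ≠ u → (G.Adj c w ↔ tw ∧ G.Adj c u)) :
    Dec G (insert w S) {x | x ∈ M ∨ x = w ∧ tw ∧ u ∈ M} := by
  classical
  induction h with
  | leaf x =>
    obtain rfl : u = x := hu
    refine .node (if tw then (if G.Adj u w then Op.K else Op.U) else Op.X) (.leaf u) (.leaf w)
      (by simpa using fun e : u = w => hw e.symm) ?_ ?_ ?_
    · rintro a rfl b rfl
      by_cases h1 : tw <;> by_cases h2 : G.Adj a b <;> simp_all
    · intro x
      simp [or_comm]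
    · intro x
      by_cases h1 : tw <;> by_cases h2 : G.Adj u w <;> simp_all
  | @node S₁ M₁ S₂ M₂ S M c h₁ h₂ hd hadj' hS hM ih₁ ih₂ =>
    have hw₁ : w ∉ S₁ := fun e => hw ((hS w).2 (.inl e))
    have hw₂ : w ∉ S₂ := fun e => hw ((hS w).2 (.inr e))
    have hm₁ : w ∉ M₁ := fun e => hw₁ (h₁.subset e)
    have hm₂ : w ∉ M₂ := fun e => hw₂ (h₂.subset e)
    rw [Set.disjoint_left] at hd
    rcases (hS u).1 hu with hu' | hu'
    · have hum : u ∉ M₂ := fun e => hd hu' (h₂.subset e)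
      refine .node c (ih₁ hu' hw₁ fun c hc => hadj c ((hS c).2 (.inl hc))) h₂ ?_ ?_ ?_ ?_
      · rw [Set.disjoint_left]
        rintro a (rfl | ha)
        · exact hw₂
        · exact hd ha
      · rintro a (rfl | ha) b hb
        · have hbu : b ≠ u := fun e => hd hu' (e ▸ hb)
          rw [G.adj_comm, hadj b ((hS b).2 (.inr hb)) hbu, G.adj_comm, hadj' u hu' b hb]
          simp only [Set.mem_ofPred_eq]
          clear * - hum hm₁ hm₂
          tauto
        · have haw : a ≠ w := fun e => hw₁ (e ▸ ha)
          rw [hadj' a ha b hb]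
          simp [haw]
      · intro x
        simp only [Set.mem_insert_iff, hS]
        clear * -
        tauto
      · intro x
        simp only [Set.mem_ofPred_eq, hM]
        clear * - hum
        tauto
    · have hum : u ∉ M₁ := fun e => hd (h₁.subset e) hu'
      refine .node c h₁ (ih₂ hu' hw₂ fun c hc => hadj c ((hS c).2 (.inr hc))) ?_ ?_ ?_ ?_
      · rw [Set.disjoint_right]
        rintro a (rfl | ha)
        · exact hw₁
        · exact fun e => hd e ha
      · rintro a ha b (rfl | hb)
        · have hau : a ≠ u := fun e => hd (e ▸ ha) hu'
          rw [hadj a ((hS a).2 (.inl ha)) hau, hadj' a ha u hu']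
          simp only [Set.mem_ofPred_eq]
          clear * - hum hm₁ hm₂
          tauto
        · have hbw : b ≠ w := fun e => hw₂ (e ▸ hb)
          rw [hadj' a ha b hb]
          simp [hbw]
      · intro x
        simp only [Set.mem_insert_iff, hS]
        clear * -
        tauto
      · intro x
        simp only [Set.mem_ofPred_eq, hM]
        tauto

/-- A connected distance-hereditary graph with a root is described by a decomposition of the
remaining vertices, the marks being the neighbours of the root. -/
theorem DHOn.dec [Finite V] {r p : V} (hd : DHOn G S) (hS : Conn G S) (hr : r ∈ S) (hp : p ∈ S)
    (hpr : p ≠ r) : Dec G (S \ {r}) {x | x ∈ S ∧ G.Adj x r} := by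
  induction hn : S.ncard using Nat.strong_induction_on generalizing S p with
  | _ n ih =>
    by_cases hq : ∃ q ∈ S, p ≠ q ∧ q ≠ r
    · obtain ⟨q, hq, hpq, hqr⟩ := hq
      obtain ⟨u, hu, w, hw, huw, hur, hwr, h⟩ := hd.exists_twins_or_pendant hS hr hp hq hpq hpr hqr
      obtain ⟨tw, hc⟩ : ∃ tw, Cherry G S u w tw := by
        rcases h with h | h
        · exact ⟨True, hu, hw, huw, .inl trivial, fun c hc h1 h2 => by rw [h c hc h1 h2]; simp⟩
        · exact ⟨False, hu, hw, huw, .inr ((h u hu).2 rfl), fun c hc h1 _ => by simp [h c hc, h1]⟩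
      have h1 := ih _ (hn ▸ Set.ncard_sdiff_singleton_lt_of_mem hw) (hd.mono Set.sdiff_subset)
        (hc.conn_diff hS) ⟨hr, hwr.symm⟩ (p := u) ⟨hu, huw⟩ hur rfl
      have h2 := h1.add_leaf (u := u) (w := w) (tw := tw) ⟨⟨hu, huw⟩, hur⟩ (by simp) hc.adj_or
        fun c hc' hcu => hc.adj_iff c hc'.1.1 hcu hc'.1.2
      convert h2 using 1
      · ext x
        by_cases hx : x = w
        · simp [hx, hw, hwr]
        · simp [hx]
      · ext x
        by_cases hx : x = w
        · subst hx
          have := hc.adj_iff r hr hur.symm hwr.symm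
          rw [G.adj_comm, G.adj_comm r u] at this
          simp only [Set.mem_ofPred_eq, Set.mem_sdiff, Set.mem_singleton_iff]
          tauto
        · simp [hx]
    · have hq' : ∀ q ∈ S, q = p ∨ q = r := by
        intro q hqS
        by_contra h
        push Not at h
        exact hq ⟨q, hqS, h.1.symm, h.2⟩
      obtain ⟨c, hc, hpc⟩ := hS.exists_adj hp hr hpr
      obtain rfl : c = r := (hq' c hc).resolve_left hpc.ne'
      convert Dec.leaf p using 1
      · ext x
        constructor
        · rintro ⟨hx, hxc⟩
          exact (hq' x hx).resolve_right hxc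
        · rintro rfl
          exact ⟨hp, hpr⟩
      · ext x
        constructor
        · rintro ⟨hx, hxc⟩
          exact (hq' x hx).resolve_right hxc.ne
        · rintro rfl
          exact ⟨hp, hpc⟩

theorem Dec.exists_cherry (h : Dec G S M) : (∃ x, S = {x} ∧ M = {x}) ∨
    ∃ u w tw, Cherry G S u w tw ∧ (w ∈ M ↔ tw ∧ u ∈ M) ∧ Dec G (S \ {w}) (M \ {w}) := by
  induction h with
  | leaf x => exact .inl ⟨x, rfl, rfl⟩
  | @node S₁ M₁ S₂ M₂ S M c h₁ h₂ hd hadj hS hM ih₁ ih₂ =>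
    right
    rw [Set.disjoint_left] at hd
    have hs₁ := h₁.subset
    have hs₂ := h₂.subset
    rcases ih₁ with ⟨a, rfl, rfl⟩ | ⟨u, w, tw, hc, hm, hdec⟩
    · rcases ih₂ with ⟨b, rfl, rfl⟩ | ⟨u, w, tw, hc, hm, hdec⟩
      · have hab : a ≠ b := by simpa using hd
        have hadj' := hadj a rfl b rfl
        have haM : a ∈ M := (hM a).2 (.inl rfl)
        have hbM : b ∈ M ↔ c ≠ Op.X := by rw [hM]; simp [hab.symm]
        refine ⟨a, b, c ≠ Op.X, ⟨(hS a).2 (.inl rfl), (hS b).2 (.inr rfl), hab, ?_, ?_⟩, ?_, ?_⟩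
        · cases c <;> simp_all
        · intro x hx hxa hxb
          rcases (hS x).1 hx with h | h
          · exact absurd h hxa
          · exact absurd h hxb
        · rw [hbM]
          simp [haM]
        · convert Dec.leaf a using 1
          · ext x
            simp only [Set.mem_sdiff, hS, Set.mem_singleton_iff]
            constructor
            · tauto
            · rintro rfl; tauto
          · ext x
            simp only [Set.mem_sdiff, hM, Set.mem_singleton_iff]
            constructor
            · tauto
            · rintro rfl; tauto
      · have hw := hc.right_mem
        have hu := hc.left_mem
        have hw₁ := fun e => hd e hw
        have hu₁ := fun e => hd e hu
        refine ⟨u, w, tw, ⟨(hS u).2 (.inr hu), (hS w).2 (.inr hw), hc.ne, hc.adj_or, ?_⟩, ?_, ?_⟩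
        · intro x hx hxu hxw
          rcases (hS x).1 hx with h | h
          · rw [hadj x h w hw, hadj x h u hu]
            tauto
          · exact hc.adj_iff x h hxu hxw
        · rw [hM, hM]
          tauto
        · refine .node c h₁ hdec ?_ ?_ ?_ ?_
          · rw [Set.disjoint_left]
            exact fun x hx hx' => hd hx hx'.1
          · intro x hx y hy
            rw [hadj x hx y hy.1]
            have := hy.2
            simp only [Set.mem_sdiff]
            tauto
          · intro x
            by_cases hxw : x = w
            · subst hxw; simp only [Set.mem_sdiff, Set.mem_singleton_iff]; tauto
            · simp [hS, hxw]
          · intro x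
            by_cases hxw : x = w
            · subst hxw
              have : x ∉ ({a} : Set V) := hw₁
              simp only [Set.mem_sdiff]
              tauto
            · simp [hM, hxw]
    · have hw := hc.right_mem
      have hu := hc.left_mem
      have hw₁ : w ∉ S₂ := fun e => hd hw e
      have hu₁ : u ∉ S₂ := fun e => hd hu e
      have hw₂ : w ∉ M₂ := fun e => hw₁ (hs₂ e)
      have hu₂ : u ∉ M₂ := fun e => hu₁ (hs₂ e)
      refine ⟨u, w, tw, ⟨(hS u).2 (.inl hu), (hS w).2 (.inl hw), hc.ne, hc.adj_or, ?_⟩, ?_, ?_⟩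
      · intro x hx hxu hxw
        rcases (hS x).1 hx with h | h
        · exact hc.adj_iff x h hxu hxw
        · rw [G.adj_comm, hadj w hw x h, G.adj_comm, hadj u hu x h]
          tauto
      · rw [hM, hM]
        tauto
      · refine .node c hdec h₂ ?_ ?_ ?_ ?_
        · rw [Set.disjoint_left]
          exact fun x hx hx' => hd hx.1 hx'
        · intro x hx y hy
          rw [hadj x hx.1 y hy]
          have := hx.2
          simp only [Set.mem_sdiff]
          tauto
        · intro x
          by_cases hxw : x = w
          · subst hxw; simp only [Set.mem_sdiff, Set.mem_singleton_iff]; tauto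
          · simp [hS, hxw]
        · intro x
          by_cases hxw : x = w
          · subst hxw
            simp only [Set.mem_sdiff, Set.mem_singleton_iff]
            tauto
          · simp [hM, hxw]

/-- A decomposed graph together with a new vertex adjacent to the marked vertices is connected
and distance-hereditary. -/
theorem Dec.conn_and_dhOn [Finite V] {r : V} (h : Dec G S M) (hr : r ∉ S)
    (hM : ∀ x ∈ S, G.Adj x r ↔ x ∈ M) : Conn G (insert r S) ∧ DHOn G (insert r S) := by
  induction hn : S.ncard using Nat.strong_induction_on generalizing S M with
  | _ n ih =>
    rcases h.exists_cherry with ⟨x, rfl, rfl⟩ | ⟨u, w, tw, hc, hm, hdec⟩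
    · have hxr : G.Adj x r := (hM x rfl).2 rfl
      refine ⟨(conn_singleton x).insert_adj rfl hxr.symm, ?_⟩
      intro T hT _ a ha b hb n hn
      by_cases hab : a = b
      · subst hab; exact .refl ha
      have hn1 : 1 ≤ n := by
        cases hn with
        | refl => exact absurd rfl hab
        | step => omega
      refine (Reach.of_adj ha hb ?_).mono hn1
      rcases hT ha with h1 | h1 <;> rcases hT hb with h2 | h2
      · exact absurd (h1.trans h2.symm) hab
      · obtain rfl : b = x := h2
        exact h1 ▸ hxr.symm
      · obtain rfl : a = x := h1
        exact h2 ▸ hxr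
      · exact absurd (Eq.trans h1 (Eq.symm h2)) hab
    · have hu := hc.left_mem
      have hw := hc.right_mem
      have hru : r ≠ u := fun e => hr (e ▸ hu)
      have hrw : r ≠ w := fun e => hr (e ▸ hw)
      have hc' : Cherry G (insert r S) u w tw := by
        refine ⟨.inr hu, .inr hw, hc.ne, hc.adj_or, ?_⟩
        rintro c (rfl | hcS) hcu hcw
        · rw [G.adj_comm, hM w hw, G.adj_comm, hM u hu, hm]
        · exact hc.adj_iff c hcS hcu hcw
      have h1 := ih _ (hn ▸ Set.ncard_sdiff_singleton_lt_of_mem hw) hdec (fun e => hr e.1)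
        (by
          rintro x ⟨hx, hxw⟩
          rw [hM x hx]
          exact ⟨fun h => ⟨h, hxw⟩, fun h => h.1⟩) rfl
      have he : insert r (S \ {w}) = insert r S \ {w} := by
        ext x
        by_cases hx : x = r
        · simp [hx, hrw]
        · simp [hx]
      rw [he] at h1
      exact ⟨hc'.conn h1.1 (.inl rfl) hru hrw, hc'.dhOn h1.2⟩

end Dec

end DistHered

namespace DistHered

/-- A graph with a set of marked vertices. -/
structure MG where
  /-- The vertices. -/
  V : Type
  /-- The graph. -/
  G : SimpleGraph V
  /-- The marked vertices. -/
  M : V → Prop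

namespace MG

/-- Two marked graphs are isomorphic. -/
def Iso (A B : MG) : Prop :=
  ∃ e : A.V ≃ B.V, (∀ x y, B.G.Adj (e x) (e y) ↔ A.G.Adj x y) ∧ ∀ x, B.M (e x) ↔ A.M x

/-- A single marked vertex. -/
def leaf : MG := ⟨Unit, ⊥, fun _ => True⟩

/-- Composition of marked graphs. -/
def node (c : Op) (A B : MG) : MG where
  V := A.V ⊕ B.V
  G :=
    { Adj := fun x y => match x, y with
        | .inl x, .inl y => A.G.Adj x y
        | .inl x, .inr y => c ≠ Op.U ∧ A.M x ∧ B.M y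
        | .inr y, .inl x => c ≠ Op.U ∧ A.M x ∧ B.M y
        | .inr x, .inr y => B.G.Adj x y
      symm := ⟨by
        rintro (x | x) (y | y) h
        · exact A.G.adj_symm h
        · exact h
        · exact h
        · exact B.G.adj_symm h⟩
      loopless := ⟨by
        rintro (x | x) h
        · exact A.G.loopless.irrefl x h
        · exact B.G.loopless.irrefl x h⟩ }
  M := fun x => match x with
    | .inl x => A.M x
    | .inr x => c ≠ Op.X ∧ B.M x

/-- The marked graph in which the adjacencies between marked vertices are complemented. -/
def dual (A : MG) : MG where
  V := A.V
  G :=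
    { Adj := fun x y => x ≠ y ∧ (A.G.Adj x y ↔ ¬(A.M x ∧ A.M y))
      symm := ⟨by
        rintro x y ⟨h, h'⟩
        exact ⟨h.symm, by rw [A.G.adj_comm, h', and_comm]⟩⟩
      loopless := ⟨fun x h => h.1 rfl⟩ }
  M := A.M

section

variable {A B C A' B' : MG} {c : Op}

@[simp] theorem node_inl_inr (x : A.V) (y : B.V) :
    (node c A B).G.Adj (Sum.inl x) (Sum.inr y) ↔ c ≠ Op.U ∧ A.M x ∧ B.M y := Iff.rfl

@[simp] theorem node_inr_inl (x : A.V) (y : B.V) :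
    (node c A B).G.Adj (Sum.inr y) (Sum.inl x) ↔ c ≠ Op.U ∧ A.M x ∧ B.M y := Iff.rfl

@[simp] theorem node_M_inl (x : A.V) : (node c A B).M (Sum.inl x) ↔ A.M x := Iff.rfl

@[simp] theorem node_M_inr (x : B.V) : (node c A B).M (Sum.inr x) ↔ c ≠ Op.X ∧ B.M x := Iff.rfl

theorem Iso.refl (A : MG) : Iso A A := ⟨Equiv.refl _, by simp, by simp⟩

theorem Iso.symm (h : Iso A B) : Iso B A := by
  obtain ⟨e, h1, h2⟩ := h
  exact ⟨e.symm, fun x y => by rw [← h1]; simp, fun x => by rw [← h2]; simp⟩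

theorem Iso.trans (h : Iso A B) (h' : Iso B C) : Iso A C := by
  obtain ⟨e, h1, h2⟩ := h
  obtain ⟨e', h1', h2'⟩ := h'
  exact ⟨e.trans e', fun x y => by simp [h1, h1'], fun x => by simp [h2, h2']⟩

theorem Iso.node (c : Op) (h : Iso A A') (h' : Iso B B') : Iso (node c A B) (node c A' B') := by
  obtain ⟨e, h1, h2⟩ := h
  obtain ⟨e', h1', h2'⟩ := h'
  refine ⟨Equiv.sumCongr e e', ?_, ?_⟩
  · rintro (x | x) (y | y)
    · exact h1 x y
    · exact and_congr Iff.rfl (and_congr (h2 x) (h2' y))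
    · exact and_congr Iff.rfl (and_congr (h2 y) (h2' x))
    · exact h1' x y
  · rintro (x | x)
    · exact h2 x
    · exact and_congr Iff.rfl (h2' x)

theorem iso_union_comm (A B : MG) : Iso (MG.node Op.U A B) (MG.node Op.U B A) := by
  refine ⟨Equiv.sumComm _ _, ?_, ?_⟩
  · rintro (x | x) (y | y) <;>
      first | exact Iff.rfl | exact iff_of_false (fun h => h.1 rfl) (fun h => h.1 rfl)
  · rintro (x | x)
    · exact ⟨fun h => h.2, fun h => ⟨nofun, h⟩⟩
    · exact ⟨fun h => ⟨nofun, h⟩, fun h => h.2⟩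

theorem iso_union_assoc (A B C : MG) :
    Iso (MG.node Op.U (MG.node Op.U A B) C) (MG.node Op.U A (MG.node Op.U B C)) := by
  refine ⟨Equiv.sumAssoc _ _ _, ?_, ?_⟩
  · rintro ((x | x) | x) ((y | y) | y) <;>
      first | exact Iff.rfl | exact iff_of_false (fun h => h.1 rfl) (fun h => h.1 rfl)
  · rintro ((x | x) | x)
    · exact Iff.rfl
    · exact Iff.rfl
    · exact ⟨fun h => h.2, fun h => ⟨h.1, h⟩⟩

theorem iso_attach_attach (A B C : MG) :
    Iso (MG.node Op.X (MG.node Op.X A B) C) (MG.node Op.X A (MG.node Op.U B C)) := by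
  refine ⟨Equiv.sumAssoc _ _ _, ?_, ?_⟩
  · rintro ((x | x) | x) ((y | y) | y) <;>
      first
      | exact Iff.rfl
      | exact iff_of_false (fun h => h.1 rfl) (fun h => h.2.1.1 rfl)
      | exact ⟨fun h => ⟨h.1, h.2.1, h.2.2.2⟩, fun h => ⟨h.1, h.2.1, nofun, h.2.2⟩⟩
  · rintro ((x | x) | x)
    · exact Iff.rfl
    · exact Iff.rfl
    · exact iff_of_false (fun h => h.1 rfl) (fun h => h.1 rfl)

theorem Iso.dual (h : Iso A B) : Iso A.dual B.dual := by
  obtain ⟨e, h1, h2⟩ := h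
  refine ⟨e, fun x y => ?_, h2⟩
  exact and_congr (not_congr e.apply_eq_iff_eq)
    (iff_congr (h1 x y) (not_congr (and_congr (h2 x) (h2 y))))

theorem iso_dual_dual (A : MG) : Iso A.dual.dual A := by
  refine ⟨Equiv.refl _, fun x y => ?_, fun x => Iff.rfl⟩
  change A.G.Adj x y ↔ x ≠ y ∧ ((x ≠ y ∧ (A.G.Adj x y ↔ ¬(A.M x ∧ A.M y))) ↔ ¬(A.M x ∧ A.M y))
  have := A.G.ne_of_adj (a := x) (b := y)
  tauto

theorem iso_dual_leaf : Iso leaf.dual leaf := by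
  refine ⟨Equiv.refl _, fun x y => ?_, fun x => Iff.rfl⟩
  exact iff_of_false (fun h => leaf.G.ne_of_adj h rfl) (fun h => leaf.dual.G.ne_of_adj h rfl)

theorem iso_dual_node_union (A B : MG) :
    Iso (MG.node Op.U A B).dual (MG.node Op.K A.dual B.dual) := by
  refine ⟨Equiv.refl _, ?_, ?_⟩
  · rintro (x | x) (y | y)
    · exact and_congr (not_congr Sum.inl.inj_iff.symm) Iff.rfl
    · change (Op.K ≠ Op.U ∧ A.M x ∧ B.M y) ↔
        Sum.inl x ≠ Sum.inr y ∧ ((Op.U ≠ Op.U ∧ A.M x ∧ B.M y) ↔ ¬(A.M x ∧ Op.U ≠ Op.X ∧ B.M y))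
      simp
    · change (Op.K ≠ Op.U ∧ A.M y ∧ B.M x) ↔
        Sum.inr x ≠ Sum.inl y ∧ ((Op.U ≠ Op.U ∧ A.M y ∧ B.M x) ↔ ¬((Op.U ≠ Op.X ∧ B.M x) ∧ A.M y))
      simp
      tauto
    · refine and_congr (not_congr Sum.inr.inj_iff.symm) (iff_congr Iff.rfl ?_)
      simp
  · rintro (x | x)
    · exact Iff.rfl
    · exact ⟨fun h => ⟨nofun, h.2⟩, fun h => ⟨nofun, h.2⟩⟩

theorem iso_dual_node_join (A B : MG) :
    Iso (MG.node Op.K A B).dual (MG.node Op.U A.dual B.dual) :=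
  ((((iso_dual_dual A).symm.node Op.K (iso_dual_dual B).symm).trans
    (iso_dual_node_union A.dual B.dual).symm).dual).trans (iso_dual_dual _)

theorem iso_dual_node_attach (A B : MG) :
    Iso (MG.node Op.X A B).dual (MG.node Op.X A.dual B) := by
  refine ⟨Equiv.refl _, ?_, ?_⟩
  · rintro (x | x) (y | y)
    · exact and_congr (not_congr Sum.inl.inj_iff.symm) Iff.rfl
    · change (Op.X ≠ Op.U ∧ A.M x ∧ B.M y) ↔
        Sum.inl x ≠ Sum.inr y ∧ ((Op.X ≠ Op.U ∧ A.M x ∧ B.M y) ↔ ¬(A.M x ∧ Op.X ≠ Op.X ∧ B.M y))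
      simp
    · change (Op.X ≠ Op.U ∧ A.M y ∧ B.M x) ↔
        Sum.inr x ≠ Sum.inl y ∧ ((Op.X ≠ Op.U ∧ A.M y ∧ B.M x) ↔ ¬((Op.X ≠ Op.X ∧ B.M x) ∧ A.M y))
      simp
    · change B.G.Adj x y ↔ (Sum.inr x : A.V ⊕ B.V) ≠ Sum.inr y ∧
        (B.G.Adj x y ↔ ¬((Op.X ≠ Op.X ∧ B.M x) ∧ (Op.X ≠ Op.X ∧ B.M y)))
      have := B.G.ne_of_adj (a := x) (b := y)
      simp
      tauto
  · rintro (x | x) <;> exact Iff.rfl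

/-- Every vertex is joined by a path to a marked vertex. -/
def Rooted (A : MG) : Prop :=
  ∀ x, ∃ m, A.M m ∧ A.G.Reachable x m

theorem reachable_inl {x y : A.V} (h : A.G.Reachable x y) :
    (MG.node c A B).G.Reachable (Sum.inl x) (Sum.inl y) :=
  h.map ⟨fun z => (Sum.inl z : A.V ⊕ B.V), fun h => h⟩

theorem reachable_inr {x y : B.V} (h : B.G.Reachable x y) :
    (MG.node c A B).G.Reachable (Sum.inr x) (Sum.inr y) :=
  h.map ⟨fun z => (Sum.inr z : A.V ⊕ B.V), fun h => h⟩

theorem Rooted.node (hA : A.Rooted) (hB : B.Rooted) [Nonempty A.V] (c : Op) :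
    (MG.node c A B).Rooted := by
  rintro (x | x)
  · obtain ⟨m, hm, h⟩ := hA x
    exact ⟨Sum.inl m, hm, reachable_inl h⟩
  · obtain ⟨m, hm, h⟩ := hB x
    by_cases hc : c = Op.X
    · obtain ⟨m', hm', -⟩ := hA (Classical.arbitrary _)
      refine ⟨Sum.inl m', hm', (reachable_inr h).trans (SimpleGraph.Adj.reachable ?_)⟩
      simp [hc, hm', hm]
    · exact ⟨Sum.inr m, ⟨hc, hm⟩, reachable_inr h⟩

theorem preconnected_node (hA : A.Rooted) (hB : B.Rooted) [Nonempty A.V] [Nonempty B.V]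
    (hc : c ≠ Op.U) : (MG.node c A B).G.Preconnected := by
  obtain ⟨a, ha, -⟩ := hA (Classical.arbitrary _)
  obtain ⟨b, hb, -⟩ := hB (Classical.arbitrary _)
  have h1 : ∀ y : B.V, B.M y → (MG.node c A B).G.Reachable (Sum.inr y) (Sum.inl a) := fun y hy =>
    SimpleGraph.Adj.reachable ⟨hc, ha, hy⟩
  have h2 : ∀ x : A.V, A.M x → (MG.node c A B).G.Reachable (Sum.inl x) (Sum.inl a) := fun x hx =>
    (SimpleGraph.Adj.reachable (show (MG.node c A B).G.Adj (Sum.inl x) (Sum.inr b) from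
      ⟨hc, hx, hb⟩)).trans (h1 b hb)
  have h3 : ∀ x, (MG.node c A B).G.Reachable x (Sum.inl a) := by
    rintro (x | x)
    · obtain ⟨m, hm, h⟩ := hA x
      exact (reachable_inl h).trans (h2 m hm)
    · obtain ⟨m, hm, h⟩ := hB x
      exact (reachable_inr h).trans (h1 m hm)
  exact fun x y => (h3 x).trans (h3 y).symm

theorem not_reachable_union {x : A.V} {y : B.V} :
    ¬ (MG.node Op.U A B).G.Reachable (Sum.inl x) (Sum.inr y) := by
  rintro ⟨p⟩
  have key : ∀ {u v : (MG.node Op.U A B).V}, (MG.node Op.U A B).G.Walk u v →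
      Sum.isLeft (α := A.V) (β := B.V) u = Sum.isLeft (α := A.V) (β := B.V) v := by
    intro u v p
    induction p with
    | nil => rfl
    | @cons u v w h _ ih =>
      rw [← ih]
      rcases u with u | u <;> rcases v with v | v <;> simp_all
  simpa using key p

theorem not_preconnected_union [Nonempty A.V] [Nonempty B.V] :
    ¬ (MG.node Op.U A B).G.Preconnected := fun h =>
  not_reachable_union (h (Sum.inl (Classical.arbitrary A.V)) (Sum.inr (Classical.arbitrary B.V)))

theorem Iso.preconnected (h : Iso A B) (hA : A.G.Preconnected) : B.G.Preconnected := by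
  obtain ⟨e, h1, -⟩ := h
  exact hA.map ⟨e, fun h => (h1 _ _).2 h⟩ e.surjective

/-- A set of unmarked vertices whose outward neighbourhoods are empty or consist of the
marked vertices. -/
def Detached (A : MG) (D : Set A.V) : Prop :=
  ∀ x ∈ D, ¬ A.M x ∧ ((∀ y, y ∉ D → ¬ A.G.Adj x y) ∨ ∀ y, y ∉ D → (A.G.Adj x y ↔ A.M y))

theorem Rooted.eq_empty (hA : A.Rooted) {D : Set A.V}
    (h : ∀ x ∈ D, ¬ A.M x ∧ ∀ y, y ∉ D → ¬ A.G.Adj x y) : D = ∅ := by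
  by_contra hD
  obtain ⟨x, hx⟩ := Set.nonempty_iff_ne_empty.2 hD
  obtain ⟨m, hm, ⟨p⟩⟩ := hA x
  have key : ∀ {u v : A.V}, A.G.Walk u v → u ∈ D → v ∈ D := by
    intro u v p
    induction p with
    | nil => exact id
    | cons hadj _ ih =>
      intro hu
      by_contra hv
      exact (h _ hu).2 _ (fun hw => hv (ih hw)) hadj
  exact (h m (key p hx)).1 hm

theorem Detached.eq_empty_of_node [Nonempty A.V] [Nonempty B.V] (hA : A.Rooted) (hB : B.Rooted)
    (hc : c ≠ Op.X) {D : Set (MG.node c A B).V} (hD : Detached (MG.node c A B) D) : D = ∅ := by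
  obtain ⟨a, ha, -⟩ := hA (Classical.arbitrary _)
  obtain ⟨b, hb, -⟩ := hB (Classical.arbitrary _)
  refine (hA.node hB c).eq_empty fun x hx => ⟨(hD x hx).1, ?_⟩
  refine (hD x hx).2.resolve_right fun h => ?_
  have hxM := (hD x hx).1
  rcases x with x | x
  · have hbD : (Sum.inr b : A.V ⊕ B.V) ∉ D := fun hbD => (hD _ hbD).1 ⟨hc, hb⟩
    exact hxM ((h _ hbD).2 ⟨hc, hb⟩).2.1
  · have haD : (Sum.inl a : A.V ⊕ B.V) ∉ D := fun haD => (hD _ haD).1 ha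
    exact hxM ⟨hc, ((h _ haD).2 ha).2.2⟩

theorem detached_range_inr : Detached (MG.node Op.X A B) (Set.range Sum.inr) := by
  rintro _ ⟨x, rfl⟩
  refine ⟨fun h => h.1 rfl, ?_⟩
  by_cases hx : B.M x
  · right
    rintro (y | y) hy
    · simp [hx]
    · exact absurd ⟨y, rfl⟩ hy
  · left
    rintro (y | y) hy
    · simp [hx]
    · exact absurd ⟨y, rfl⟩ hy

theorem Detached.preimage_inl {D : Set (MG.node c A B).V} (hD : Detached (MG.node c A B) D) :
    Detached A {x | (Sum.inl x : A.V ⊕ B.V) ∈ D} := by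
  intro x hx
  refine ⟨(hD _ hx).1, ?_⟩
  rcases (hD _ hx).2 with h | h
  · exact .inl fun y hy => h (Sum.inl y) hy
  · exact .inr fun y hy => h (Sum.inl y) hy

theorem Iso.detached {e : A.V ≃ B.V} (h1 : ∀ x y, B.G.Adj (e x) (e y) ↔ A.G.Adj x y)
    (h2 : ∀ x, B.M (e x) ↔ A.M x) {D : Set B.V} (hD : Detached B D) : Detached A (e ⁻¹' D) := by
  intro x hx
  refine ⟨fun h => (hD _ hx).1 ((h2 x).2 h), ?_⟩
  rcases (hD _ hx).2 with h | h
  · exact .inl fun y hy hxy => h (e y) hy ((h1 _ _).2 hxy)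
  · exact .inr fun y hy => by rw [← h1, h (e y) hy, h2]

/-- A marked graph has no nonempty detached set. -/
def Tight (A : MG) : Prop := ∀ D, Detached A D → D = ∅

theorem Iso.tight (h : Iso A B) (hA : A.Tight) : B.Tight := by
  obtain ⟨e, h1, h2⟩ := h
  intro D hD
  have := hA _ (Iso.detached h1 h2 hD)
  rwa [Set.preimage_eq_empty_iff, e.range_eq_univ, Set.disjoint_univ] at this

theorem tight_leaf : leaf.Tight := by
  intro D hD
  exact Set.eq_empty_of_forall_notMem fun x hx => (hD x hx).1 trivial

theorem not_tight_attach [Nonempty B.V] : ¬ (MG.node Op.X A B).Tight := fun h => by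
  have := h _ detached_range_inr
  exact absurd this (Set.range_nonempty _).ne_empty

theorem Tight.detached_subset (hA : A.Tight) {D : Set (MG.node c A B).V}
    (hD : Detached (MG.node c A B) D) (x : A.V) : (Sum.inl x : A.V ⊕ B.V) ∉ D := fun hx => by
  have := hA _ hD.preimage_inl
  exact (this ▸ (show x ∈ {x | (Sum.inl x : A.V ⊕ B.V) ∈ D} from hx) : x ∈ (∅ : Set A.V))

theorem Iso.of_attach [Nonempty A.V] (hA : A.Tight) (hA' : A'.Tight) (hr : A.Rooted)
    (h : Iso (MG.node Op.X A B) (MG.node Op.X A' B')) : Iso A A' ∧ Iso B B' := by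
  obtain ⟨e, h1, h2⟩ := h
  have hl : ∀ x : A.V, ∃ y : A'.V, e (Sum.inl x) = Sum.inl y := by
    intro x
    rcases hy : e (Sum.inl x) with y | y
    · exact ⟨y, rfl⟩
    · exact absurd ⟨y, hy.symm⟩
        (hA.detached_subset (Iso.detached h1 h2 (detached_range_inr (A := A') (B := B'))) x)
  have hl' : ∀ x : A'.V, ∃ y : A.V, e.symm (Sum.inl x) = Sum.inl y := by
    intro x
    rcases hy : e.symm (Sum.inl x) with y | y
    · exact ⟨y, rfl⟩
    · refine absurd ⟨y, hy.symm⟩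
        (hA'.detached_subset (Iso.detached (e := e.symm) ?_ ?_
          (detached_range_inr (A := A) (B := B))) x)
      · intro x y; rw [← h1]; simp
      · intro x; rw [← h2]; simp
  have hr₁ : ∀ x : B.V, ∃ y : B'.V, e (Sum.inr x) = Sum.inr y := by
    intro x
    rcases hy : e (Sum.inr x) with y | y
    · obtain ⟨z, hz⟩ := hl' y
      exact absurd ((e.symm_apply_apply (Sum.inr x)).symm.trans ((congrArg e.symm hy).trans hz))
        Sum.inr_ne_inl
    · exact ⟨y, rfl⟩
  have hr₂ : ∀ x : B'.V, ∃ y : B.V, e.symm (Sum.inr x) = Sum.inr y := by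
    intro x
    rcases hy : e.symm (Sum.inr x) with y | y
    · obtain ⟨z, hz⟩ := hl y
      exact absurd ((e.apply_symm_apply (Sum.inr x)).symm.trans ((congrArg e hy).trans hz))
        Sum.inr_ne_inl
    · exact ⟨y, rfl⟩
  choose f hf using hl
  choose f' hf' using hl'
  choose g hg using hr₁
  choose g' hg' using hr₂
  have hM : ∀ x, A'.M (f x) ↔ A.M x := by
    intro x
    have := h2 (Sum.inl x)
    rw [hf] at this
    exact this
  constructor
  · refine ⟨⟨f, f', fun x => ?_, fun x => ?_⟩, fun x y => ?_, hM⟩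
    · exact (Sum.inl.inj ((e.symm_apply_apply (Sum.inl x)).symm.trans
        ((congrArg e.symm (hf x)).trans (hf' _)))).symm
    · exact (Sum.inl.inj ((e.apply_symm_apply (Sum.inl x)).symm.trans
        ((congrArg e (hf' x)).trans (hf _)))).symm
    · have := h1 (Sum.inl x) (Sum.inl y)
      rw [hf, hf] at this
      exact this
  · obtain ⟨a, ha, -⟩ := hr (Classical.arbitrary _)
    refine ⟨⟨g, g', fun x => ?_, fun x => ?_⟩, fun x y => ?_, fun x => ?_⟩
    · exact (Sum.inr.inj ((e.symm_apply_apply (Sum.inr x)).symm.trans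
        ((congrArg e.symm (hg x)).trans (hg' _)))).symm
    · exact (Sum.inr.inj ((e.apply_symm_apply (Sum.inr x)).symm.trans
        ((congrArg e (hg' x)).trans (hg _)))).symm
    · have := h1 (Sum.inr x) (Sum.inr y)
      rw [hg, hg] at this
      exact this
    · have := h1 (Sum.inl a) (Sum.inr x)
      rw [hf, hg] at this
      have h3 := hM a
      simp only [node_inl_inr] at this
      change B'.M (g x) ↔ _
      simp_all

/-- A full embedding of marked graphs whose image is a union of connected components. -/
structure IsClosedEmb (A B : MG) (f : A.V → B.V) : Prop where
  inj : Function.Injective f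
  adj : ∀ x y, B.G.Adj (f x) (f y) ↔ A.G.Adj x y
  mark : ∀ x, B.M (f x) ↔ A.M x
  closed : ∀ x y, B.G.Adj (f x) y → y ∈ Set.range f

/-- The number of closed embeddings. -/
noncomputable def numEmb (A B : MG) : ℕ := {f | IsClosedEmb A B f}.ncard

theorem IsClosedEmb.comp_iso {e : B.V ≃ C.V} (h1 : ∀ x y, C.G.Adj (e x) (e y) ↔ B.G.Adj x y)
    (h2 : ∀ x, C.M (e x) ↔ B.M x) {f : A.V → B.V} (h : IsClosedEmb A B f) :
    IsClosedEmb A C (e ∘ f) := by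
  refine ⟨e.injective.comp h.inj, fun x y => by simp [h1, h.adj], fun x => by simp [h2, h.mark],
    fun x y hxy => ?_⟩
  obtain ⟨y, rfl⟩ := e.surjective y
  obtain ⟨z, rfl⟩ := h.closed x y ((h1 _ _).1 hxy)
  exact ⟨z, rfl⟩

theorem Iso.numEmb_eq (h : Iso B C) : numEmb A B = numEmb A C := by
  obtain ⟨e, h1, h2⟩ := h
  refine Set.ncard_congr (fun f _ => e ∘ f) (fun f hf => hf.comp_iso h1 h2) ?_ ?_
  · intro f g _ _ h
    exact e.injective.comp_left h
  · intro f hf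
    have h1' : ∀ x y, B.G.Adj (e.symm x) (e.symm y) ↔ C.G.Adj x y := fun x y => by
      rw [← h1]; simp
    have h2' : ∀ x, B.M (e.symm x) ↔ C.M x := fun x => by rw [← h2]; simp
    exact ⟨e.symm ∘ f, hf.comp_iso h1' h2', by ext; simp⟩

theorem IsClosedEmb.surjective {f : A.V → B.V} [Nonempty A.V] (h : IsClosedEmb A B f)
    (hB : B.G.Preconnected) : Function.Surjective f := by
  intro y
  obtain ⟨p⟩ := hB (f (Classical.arbitrary _)) y
  have key : ∀ {u v : B.V}, B.G.Walk u v → u ∈ Set.range f → v ∈ Set.range f := by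
    intro u v p
    induction p with
    | nil => exact id
    | cons hadj _ ih =>
      rintro ⟨z, rfl⟩
      exact ih (h.closed _ _ hadj)
  exact key p ⟨_, rfl⟩

theorem numEmb_self_pos (A : MG) [Finite A.V] : 0 < numEmb A A :=
  (Set.ncard_pos (Set.toFinite _)).2
    ⟨id, Function.injective_id, by simp, by simp, fun x y _ => ⟨y, rfl⟩⟩

theorem numEmb_eq_zero [Nonempty A.V] (hB : B.G.Preconnected) (h : ¬ Iso A B) :
    numEmb A B = 0 := by
  rw [numEmb, show {f | IsClosedEmb A B f} = ∅ from ?_, Set.ncard_empty]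
  refine Set.eq_empty_of_forall_notMem fun f (hf : IsClosedEmb A B f) => h ?_
  exact ⟨Equiv.ofBijective f ⟨hf.inj, hf.surjective hB⟩, hf.adj, hf.mark⟩

theorem numEmb_union {Q : MG} [Finite A.V] [Finite B.V] [Finite Q.V] [Nonempty Q.V]
    (hQ : Q.G.Preconnected) : numEmb Q (MG.node Op.U A B) = numEmb Q A + numEmb Q B := by
  have hi : Function.Injective fun f : Q.V → A.V => ((Sum.inl ∘ f : Q.V → A.V ⊕ B.V)) :=
    Sum.inl_injective.comp_left
  have hj : Function.Injective fun f : Q.V → B.V => ((Sum.inr ∘ f : Q.V → A.V ⊕ B.V)) :=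
    Sum.inr_injective.comp_left
  rw [numEmb, numEmb, numEmb, ← Set.ncard_image_of_injective {f | IsClosedEmb Q A f} hi,
    ← Set.ncard_image_of_injective {f | IsClosedEmb Q B f} hj, ← Set.ncard_union_eq]
  · congr 1
    ext f
    constructor
    · intro (hf : IsClosedEmb Q (MG.node Op.U A B) f)
      have key : ∀ x y, (MG.node Op.U A B).G.Reachable (f x) (f y) := fun x y =>
        (hQ x y).map ⟨f, fun h => (hf.adj _ _).2 h⟩
      have q := Classical.arbitrary Q.V
      rcases hq : f q with a | b
      · left
        have hl : ∀ x, ∃ a, f x = Sum.inl a := by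
          intro x
          rcases hx : f x with a' | b'
          · exact ⟨a', rfl⟩
          · have := key q x
            rw [hq, hx] at this
            exact absurd this not_reachable_union
        choose g hg using hl
        refine ⟨g, ⟨fun x y h => hf.inj (by rw [hg, hg, h]), fun x y => ?_, fun x => ?_,
          fun x y hxy => ?_⟩, (funext hg).symm⟩
        · rw [← hf.adj, hg, hg]; rfl
        · rw [← hf.mark, hg]; rfl
        · obtain ⟨z, hz⟩ := hf.closed x (Sum.inl y) (by rw [hg]; exact hxy)
          exact ⟨z, Sum.inl_injective ((hg z).symm.trans hz)⟩
      · right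
        have hl : ∀ x, ∃ b, f x = Sum.inr b := by
          intro x
          rcases hx : f x with a' | b'
          · have := key x q
            rw [hq, hx] at this
            exact absurd this not_reachable_union
          · exact ⟨b', rfl⟩
        choose g hg using hl
        refine ⟨g, ⟨fun x y h => hf.inj (by rw [hg, hg, h]), fun x y => ?_, fun x => ?_,
          fun x y hxy => ?_⟩, (funext hg).symm⟩
        · rw [← hf.adj, hg, hg]; rfl
        · rw [← hf.mark, hg]
          simp
        · obtain ⟨z, hz⟩ := hf.closed x (Sum.inr y) (by rw [hg]; exact hxy)
          exact ⟨z, Sum.inr_injective ((hg z).symm.trans hz)⟩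
    · rintro (⟨f, hf, rfl⟩ | ⟨f, hf, rfl⟩)
      · refine ⟨Sum.inl_injective.comp hf.inj, hf.adj, hf.mark, ?_⟩
        rintro x (y | y) hxy
        · obtain ⟨z, rfl⟩ := hf.closed x y hxy
          exact ⟨z, rfl⟩
        · exact absurd rfl hxy.1
      · refine ⟨Sum.inr_injective.comp hf.inj, hf.adj, fun x => ?_, ?_⟩
        · simp [← hf.mark]
        rintro x (y | y) hxy
        · exact absurd rfl hxy.1
        · obtain ⟨z, rfl⟩ := hf.closed x y hxy
          exact ⟨z, rfl⟩
  · rw [Set.disjoint_left]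
    rintro _ ⟨f, -, rfl⟩ ⟨g, -, h⟩
    exact absurd (congrFun h (Classical.arbitrary _)) Sum.inr_ne_inl

end

end MG

end DistHered

namespace DistHered

/-- Terms in the three composition operations. -/
inductive BT
  | leaf
  | node (c : Op) (a b : BT)

namespace BT

/-- The marked graph described by a term. -/
def mg : BT → MG
  | leaf => MG.leaf
  | node c a b => MG.node c a.mg b.mg

/-- The number of leaves of a term. -/
def size : BT → ℕ
  | leaf => 1
  | node _ a b => a.size + b.size

/-- Interchange disjoint unions and joins. -/
def dual : BT → BT
  | leaf => leaf
  | node .U a b => node .K a.dual b.dual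
  | node .K a b => node .U a.dual b.dual
  | node .X a b => node .X a.dual b

theorem size_pos (t : BT) : 0 < t.size := by
  induction t with
  | leaf => exact Nat.one_pos
  | node c a b ha hb => exact Nat.add_pos_left ha _

theorem size_dual (t : BT) : t.dual.size = t.size := by
  induction t with
  | leaf => rfl
  | node c a b ha hb => cases c <;> simp [dual, size, ha, hb]

theorem dual_dual (t : BT) : t.dual.dual = t := by
  induction t with
  | leaf => rfl
  | node c a b ha hb => cases c <;> simp [dual, ha, hb]

instance finite_V (t : BT) : Finite t.mg.V := by
  induction t with
  | leaf => exact inferInstanceAs (Finite Unit)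
  | node c a b ha hb => exact inferInstanceAs (Finite (a.mg.V ⊕ b.mg.V))

instance nonempty_V (t : BT) : Nonempty t.mg.V := by
  induction t with
  | leaf => exact inferInstanceAs (Nonempty Unit)
  | node c a b ha hb => exact inferInstanceAs (Nonempty (a.mg.V ⊕ b.mg.V))

theorem card_V (t : BT) : Nat.card t.mg.V = t.size := by
  induction t with
  | leaf => exact Nat.card_unique (α := Unit)
  | node c a b ha hb => exact (Nat.card_sum (α := a.mg.V) (β := b.mg.V)).trans (by rw [ha, hb]; rfl)

theorem rooted (t : BT) : t.mg.Rooted := by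
  induction t with
  | leaf => exact fun x => ⟨x, trivial, .rfl⟩
  | node c a b ha hb => exact ha.node hb c

theorem iso_dual (t : BT) : t.dual.mg.Iso t.mg.dual := by
  induction t with
  | leaf => exact MG.iso_dual_leaf.symm
  | node c a b ha hb =>
    cases c
    · exact (ha.node _ hb).trans (MG.iso_dual_node_union _ _).symm
    · exact (ha.node _ hb).trans (MG.iso_dual_node_join _ _).symm
    · exact (ha.node _ (.refl _)).trans (MG.iso_dual_node_attach _ _).symm

/-- Terms describing isomorphic marked graphs are identified. -/
instance setoid : Setoid BT where
  r a b := a.mg.Iso b.mg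
  iseqv := ⟨fun _ => .refl _, .symm, .trans⟩

theorem preconnected_or (t : BT) : t.mg.G.Preconnected ∨ ∃ a b, t = node .U a b := by
  cases t with
  | leaf => exact .inl fun x y => .rfl
  | node c a b =>
    by_cases hc : c = Op.U
    · subst hc; exact .inr ⟨a, b, rfl⟩
    · exact .inl (MG.preconnected_node a.rooted b.rooted hc)

theorem not_preconnected_union (a b : BT) : ¬ (node .U a b).mg.G.Preconnected :=
  MG.not_preconnected_union (A := a.mg) (B := b.mg)

theorem tight_or (t : BT) : t.mg.Tight ∨ ∃ a b, t = node .X a b := by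
  cases t with
  | leaf => exact .inl MG.tight_leaf
  | node c a b =>
    by_cases hc : c = Op.X
    · subst hc; exact .inr ⟨a, b, rfl⟩
    · exact .inl fun D hD => hD.eq_empty_of_node a.rooted b.rooted hc

theorem not_tight_attach (a b : BT) : ¬ (node .X a b).mg.Tight :=
  MG.not_tight_attach (A := a.mg) (B := b.mg)

end BT

/-- Isomorphism classes of marked graphs described by terms. -/
def Cl := Quotient BT.setoid

namespace Cl

/-- The class of a term. -/
def mk (t : BT) : Cl := Quotient.mk _ t

theorem exists_mk (t : Cl) : ∃ b, mk b = t := Quotient.exists_rep t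

/-- The class of a single marked vertex. -/
def leaf : Cl := mk .leaf

/-- Composition of classes. -/
def node (c : Op) : Cl → Cl → Cl :=
  Quotient.map₂ (BT.node c) fun _ _ h _ _ hb => h.node c hb

/-- The number of vertices. -/
def size : Cl → ℕ :=
  Quotient.lift BT.size fun a b h => by
    obtain ⟨e, -⟩ := h
    rw [← BT.card_V, ← BT.card_V, Nat.card_congr e]

/-- Interchange disjoint unions and joins. -/
def dual : Cl → Cl :=
  Quotient.map BT.dual fun a b h => (a.iso_dual.trans (MG.Iso.dual h)).trans b.iso_dual.symm

/-- The class is a composition with the given operation. -/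
def IsOp (c : Op) (t : Cl) : Prop := ∃ a b, t = node c a b

theorem eq_leaf_or_node (t : Cl) : t = leaf ∨ ∃ c a b, t = node c a b := by
  induction t using Quotient.inductionOn with
  | h t =>
    cases t with
    | leaf => exact .inl rfl
    | node c a b => exact .inr ⟨c, Quotient.mk _ a, Quotient.mk _ b, rfl⟩

@[elab_as_elim]
theorem induction {p : Cl → Prop} (leaf : p leaf) (node : ∀ c a b, p a → p b → p (node c a b))
    (t : Cl) : p t := by
  induction t using Quotient.inductionOn with
  | h t =>
    induction t with
    | leaf => exact leaf
    | node c a b ha hb => exact node c (Quotient.mk _ a) (Quotient.mk _ b) ha hb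

@[simp] theorem size_leaf : leaf.size = 1 := rfl

@[simp] theorem size_node (c : Op) (a b : Cl) : (node c a b).size = a.size + b.size := by
  induction a using Quotient.inductionOn with
  | h a =>
    induction b using Quotient.inductionOn with
    | h b => rfl

theorem size_pos (t : Cl) : 0 < t.size := by
  induction t using Quotient.inductionOn with
  | h t => exact t.size_pos

theorem size_dual (t : Cl) : t.dual.size = t.size := by
  induction t using Quotient.inductionOn with
  | h t => exact t.size_dual

theorem dual_dual (t : Cl) : t.dual.dual = t := by
  induction t using Quotient.inductionOn with
  | h t => exact congrArg (Quotient.mk BT.setoid) t.dual_dual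

theorem dual_node_union (a b : Cl) : (node .U a b).dual = node .K a.dual b.dual := by
  induction a using Quotient.inductionOn with
  | h a =>
    induction b using Quotient.inductionOn with
    | h b => rfl

theorem dual_node_join (a b : Cl) : (node .K a b).dual = node .U a.dual b.dual := by
  induction a using Quotient.inductionOn with
  | h a =>
    induction b using Quotient.inductionOn with
    | h b => rfl

theorem isOp_union_dual {t : Cl} : t.dual.IsOp .U ↔ t.IsOp .K := by
  constructor
  · rintro ⟨a, b, h⟩
    exact ⟨a.dual, b.dual, by rw [← dual_node_union, ← h, dual_dual]⟩
  · rintro ⟨a, b, rfl⟩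
    exact ⟨a.dual, b.dual, dual_node_join a b⟩

theorem node_union_comm (a b : Cl) : node .U a b = node .U b a := by
  induction a using Quotient.inductionOn with
  | h a =>
    induction b using Quotient.inductionOn with
    | h b => exact Quotient.sound (MG.iso_union_comm _ _)

theorem node_union_assoc (a b c : Cl) : node .U (node .U a b) c = node .U a (node .U b c) := by
  induction a using Quotient.inductionOn with
  | h a =>
    induction b using Quotient.inductionOn with
    | h b =>
      induction c using Quotient.inductionOn with
      | h c => exact Quotient.sound (MG.iso_union_assoc _ _ _)

theorem node_attach_attach (a b c : Cl) : node .X (node .X a b) c = node .X a (node .U b c) := by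
  induction a using Quotient.inductionOn with
  | h a =>
    induction b using Quotient.inductionOn with
    | h b =>
      induction c using Quotient.inductionOn with
      | h c => exact Quotient.sound (MG.iso_attach_attach _ _ _)

theorem isOp_union_iff (t : BT) : IsOp .U (mk t) ↔ ¬ t.mg.G.Preconnected := by
  constructor
  · rintro ⟨a, b, h⟩ hc
    induction a using Quotient.inductionOn with
    | h a =>
      induction b using Quotient.inductionOn with
      | h b => exact BT.not_preconnected_union a b (MG.Iso.preconnected (Quotient.exact h) hc)
  · intro h
    obtain ⟨a, b, rfl⟩ := t.preconnected_or.resolve_left h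
    exact ⟨Quotient.mk _ a, Quotient.mk _ b, rfl⟩

theorem isOp_attach_iff (t : BT) : IsOp .X (mk t) ↔ ¬ t.mg.Tight := by
  constructor
  · rintro ⟨a, b, h⟩ hc
    induction a using Quotient.inductionOn with
    | h a =>
      induction b using Quotient.inductionOn with
      | h b => exact BT.not_tight_attach a b (MG.Iso.tight (Quotient.exact h) hc)
  · intro h
    obtain ⟨a, b, rfl⟩ := t.tight_or.resolve_left h
    exact ⟨Quotient.mk _ a, Quotient.mk _ b, rfl⟩

theorem not_isOp_union_node {c : Op} (hc : c ≠ .U) (a b : Cl) : ¬ (node c a b).IsOp .U := by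
  induction a using Quotient.inductionOn with
  | h a =>
    induction b using Quotient.inductionOn with
    | h b =>
      exact fun h => (isOp_union_iff (.node c a b)).1 h
        (MG.preconnected_node a.rooted b.rooted hc)

theorem not_isOp_attach_node {c : Op} (hc : c ≠ .X) (a b : Cl) : ¬ (node c a b).IsOp .X := by
  induction a using Quotient.inductionOn with
  | h a =>
    induction b using Quotient.inductionOn with
    | h b =>
      exact fun h => (isOp_attach_iff (.node c a b)).1 h
        fun D hD => hD.eq_empty_of_node a.rooted b.rooted hc

/-- The outermost operation of a composition is determined by the isomorphism class. -/
theorem IsOp.unique {t : Cl} {c c' : Op} (h : t.IsOp c) (h' : t.IsOp c') : c = c' := by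
  by_cases hX : t.IsOp .X
  · have key : ∀ {d}, t.IsOp d → d = .X := by
      rintro d ⟨a, b, rfl⟩
      by_contra hd
      exact not_isOp_attach_node hd a b hX
    rw [key h, key h']
  · by_cases hU : t.IsOp .U
    · have key : ∀ {d}, t.IsOp d → d = .U := by
        rintro d ⟨a, b, rfl⟩
        by_contra hd
        exact not_isOp_union_node hd a b hU
      rw [key h, key h']
    · have key : ∀ {d}, t.IsOp d → d = .K := by
        intro d hd
        cases d
        · exact absurd hd hU
        · rfl
        · exact absurd hd hX
      rw [key h, key h']

theorem not_isOp_leaf (c : Op) : ¬ leaf.IsOp c := by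
  rintro ⟨a, b, h⟩
  have h1 := congrArg size h
  have ha := a.size_pos
  have hb := b.size_pos
  rw [size_leaf, size_node] at h1
  omega

theorem eq_leaf_of_size {t : Cl} (h : t.size = 1) : t = leaf := by
  rcases t.eq_leaf_or_node with h' | ⟨c, a, b, rfl⟩
  · exact h'
  · have ha := a.size_pos
    have hb := b.size_pos
    rw [size_node] at h
    omega

theorem attach_injective {a a' b b' : Cl} (ha : ¬ a.IsOp .X) (ha' : ¬ a'.IsOp .X)
    (h : node .X a b = node .X a' b') : a = a' ∧ b = b' := by
  obtain ⟨a, rfl⟩ := exists_mk a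
  obtain ⟨b, rfl⟩ := exists_mk b
  obtain ⟨a', rfl⟩ := exists_mk a'
  obtain ⟨b', rfl⟩ := exists_mk b'
  rw [isOp_attach_iff, not_not] at ha ha'
  have := MG.Iso.of_attach ha ha' a.rooted (Quotient.exact h)
  exact ⟨Quotient.sound this.1, Quotient.sound this.2⟩

theorem exists_attach {t : Cl} (h : t.IsOp .X) : ∃ a b, ¬ a.IsOp .X ∧ t = node .X a b := by
  obtain ⟨a, b, rfl⟩ := h
  induction hn : a.size using Nat.strong_induction_on generalizing a b with
  | _ n ih =>
    by_cases ha : a.IsOp .X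
    · obtain ⟨a', b', rfl⟩ := ha
      rw [node_attach_attach]
      refine ih _ ?_ a' _ rfl
      have := b'.size_pos
      rw [size_node] at hn
      omega
    · exact ⟨a, b, ha, rfl⟩

instance : AddCommSemigroup Cl where
  add := node .U
  add_assoc := node_union_assoc
  add_comm := node_union_comm

theorem add_def (a b : Cl) : a + b = node .U a b := rfl

/-- The disjoint union of a multiset of classes. -/
noncomputable def union (s : Multiset Cl) : WithZero Cl :=
  (s.map (fun t => (t : WithZero Cl))).sum

@[simp] theorem union_zero : union 0 = 0 := rfl

@[simp] theorem union_cons (a : Cl) (s : Multiset Cl) : union (a ::ₘ s) = a + union s := by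
  simp [union]

theorem union_add (s s' : Multiset Cl) : union (s + s') = union s + union s' := by
  simp [union]

@[simp] theorem union_singleton (a : Cl) : union {a} = a := by
  simp [union]

/-- Extension of an additive map to the empty graph. -/
noncomputable def liftNat (f : Cl → ℕ) (hf : ∀ a b, f (node .U a b) = f a + f b) :
    WithZero Cl →+ ℕ :=
  WithZero.lift ⟨f, hf⟩

theorem liftNat_union {f : Cl → ℕ} (hf : ∀ a b, f (node .U a b) = f a + f b) (s : Multiset Cl) :
    liftNat f hf (union s) = (s.map f).sum := by
  induction s using Multiset.induction_on with
  | empty => simp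
  | cons a s ih => rw [union_cons, map_add, ih, Multiset.map_cons, Multiset.sum_cons]; rfl

theorem exists_union (t : Cl) : ∃ s : Multiset Cl, (∀ p ∈ s, ¬ p.IsOp .U) ∧ union s = t := by
  have key : ∀ t : Cl, ¬ t.IsOp .U → ∃ s : Multiset Cl, (∀ p ∈ s, ¬ p.IsOp .U) ∧ union s = t :=
    fun t ht => ⟨{t}, by simpa using ht, union_singleton t⟩
  induction t using induction with
  | leaf => exact key _ (not_isOp_leaf _)
  | node c a b ha hb =>
    by_cases hc : c = .U
    · subst hc
      obtain ⟨s, hs, h⟩ := ha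
      obtain ⟨s', hs', h'⟩ := hb
      refine ⟨s + s', fun p hp => ?_, ?_⟩
      · rcases Multiset.mem_add.1 hp with h | h
        · exact hs p h
        · exact hs' p h
      · rw [union_add, h, h', ← add_def, WithZero.coe_add]
    · exact key _ (not_isOp_union_node hc a b)

/-- The number of closed embeddings of one class into another. -/
noncomputable def numEmb (q : BT) : Cl → ℕ :=
  Quotient.lift (fun t => MG.numEmb q.mg t.mg) fun _ _ h => MG.Iso.numEmb_eq h

theorem numEmb_node {q : BT} (hq : ¬ IsOp .U (mk q)) (a b : Cl) :
    numEmb q (node .U a b) = numEmb q a + numEmb q b := by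
  rw [isOp_union_iff, not_not] at hq
  induction a using Quotient.inductionOn with
  | h a =>
    induction b using Quotient.inductionOn with
    | h b => exact MG.numEmb_union hq

open Classical in
theorem numEmb_eq {q : BT} (t : Cl) (ht : ¬ t.IsOp .U) :
    numEmb q t = if t = mk q then MG.numEmb q.mg q.mg else 0 := by
  obtain ⟨t, rfl⟩ := exists_mk t
  split_ifs with h
  · rw [h]; rfl
  · rw [isOp_union_iff, not_not] at ht
    exact MG.numEmb_eq_zero ht fun h' => h (Quotient.sound h'.symm)

open Classical in
theorem sum_map_numEmb {q : BT} (s : Multiset Cl) (hs : ∀ p ∈ s, ¬ p.IsOp .U) :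
    (s.map (numEmb q)).sum = s.count (mk q) * MG.numEmb q.mg q.mg := by
  induction s using Multiset.induction_on with
  | empty => simp
  | cons a s ih =>
    have h1 := ih fun p hp => hs p (Multiset.mem_cons_of_mem hp)
    have h2 := numEmb_eq (q := q) a (hs a (Multiset.mem_cons_self a s))
    rw [Multiset.map_cons, Multiset.sum_cons, h1, h2, Multiset.count_cons]
    split_ifs with h3 h4 h4
    · ring
    · exact absurd h3.symm h4
    · exact absurd h4.symm h3
    · ring

/-- Decomposition into connected components is unique. -/
theorem union_injOn {s s' : Multiset Cl} (hs : ∀ p ∈ s, ¬ p.IsOp .U)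
    (hs' : ∀ p ∈ s', ¬ p.IsOp .U) (h : union s = union s') : s = s' := by
  classical
  ext t
  by_cases ht : t.IsOp .U
  · rw [Multiset.count_eq_zero_of_notMem fun h => hs t h ht,
      Multiset.count_eq_zero_of_notMem fun h => hs' t h ht]
  obtain ⟨q, rfl⟩ := exists_mk t
  have h1 := congrArg (liftNat (numEmb q) (numEmb_node ht)) h
  rw [liftNat_union, liftNat_union, sum_map_numEmb s hs, sum_map_numEmb s' hs'] at h1
  exact Nat.eq_of_mul_eq_mul_right (MG.numEmb_self_pos _) h1

theorem size_union {s : Multiset Cl} {t : Cl} (h : union s = t) : (s.map size).sum = t.size := by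
  rw [← liftNat_union (f := size) (size_node .U), h]
  rfl

theorem finite_size_le (n : ℕ) : {t : Cl | t.size ≤ n}.Finite := by
  induction n with
  | zero =>
    convert Set.finite_empty
    ext t
    have := t.size_pos
    simp
    omega
  | succ n ih =>
    refine ((Set.finite_singleton leaf).union (((Set.Finite.image2 (node .U) ih ih).union
      (Set.Finite.image2 (node .K) ih ih)).union (Set.Finite.image2 (node .X) ih ih))).subset ?_
    intro t ht
    rcases t.eq_leaf_or_node with h | ⟨c, a, b, rfl⟩
    · exact .inl h
    · have ha := a.size_pos
      have hb := b.size_pos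
      simp only [Set.mem_ofPred_eq, size_node] at ht
      have ha' : a ∈ {t : Cl | t.size ≤ n} := by simp; omega
      have hb' : b ∈ {t : Cl | t.size ≤ n} := by simp; omega
      right
      cases c
      · exact .inl (.inl ⟨a, ha', b, hb', rfl⟩)
      · exact .inl (.inr ⟨a, ha', b, hb', rfl⟩)
      · exact .inr ⟨a, ha', b, hb', rfl⟩

end Cl

end DistHered

namespace DistHered

/-- The graph induced by `G` on `S`, with marked set `M`, is isomorphic to `A`. -/
def Realize {V : Type} (A : MG) (G : SimpleGraph V) (S M : Set V) : Prop :=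
  ∃ f : A.V → V, f.Injective ∧ Set.range f = S ∧
    (∀ x y, G.Adj (f x) (f y) ↔ A.G.Adj x y) ∧ ∀ x, f x ∈ M ↔ A.M x

section

variable {V W : Type} {A B : MG} {G : SimpleGraph V} {S M : Set V}

theorem Realize.iso (h : Realize A G S M) (h' : Realize B G S M) : A.Iso B := by
  obtain ⟨f, hf, hfS, hfA, hfM⟩ := h
  obtain ⟨g, hg, hgS, hgA, hgM⟩ := h'
  have key : ∀ x, ∃ y, g y = f x := fun x => by
    have : f x ∈ Set.range g := by rw [hgS, ← hfS]; exact ⟨x, rfl⟩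
    exact this
  choose e he using key
  have hb : e.Bijective := by
    refine ⟨fun x y h => hf ?_, fun y => ?_⟩
    · rw [← he, ← he, h]
    have : g y ∈ Set.range f := by rw [hfS, ← hgS]; exact ⟨y, rfl⟩
    obtain ⟨x, hx⟩ := this
    exact ⟨x, hg (by rw [he, hx])⟩
  refine ⟨Equiv.ofBijective e hb, fun x y => ?_, fun x => ?_⟩
  · rw [Equiv.ofBijective_apply, Equiv.ofBijective_apply, ← hgA, he, he, hfA]
  · rw [Equiv.ofBijective_apply, ← hgM, he, hfM]

theorem Realize.congr (h : Realize A G S M) (e : B.Iso A) : Realize B G S M := by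
  obtain ⟨f, hf, hfS, hfA, hfM⟩ := h
  obtain ⟨e, h1, h2⟩ := e
  refine ⟨f ∘ e, hf.comp e.injective, by rw [e.surjective.range_comp, hfS], fun x y => ?_,
    fun x => ?_⟩
  · exact (hfA _ _).trans (h1 x y)
  · exact (hfM _).trans (h2 x)

theorem Realize.map {G' : SimpleGraph W} (e : G ≃g G') {r : V}
    (h : Realize A G {r}ᶜ {x | G.Adj x r}) : Realize A G' {e r}ᶜ {x | G'.Adj x (e r)} := by
  obtain ⟨f, hf, hfS, hfA, hfM⟩ := h
  refine ⟨e ∘ f, e.injective.comp hf, ?_, fun x y => ?_, fun x => ?_⟩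
  · rw [Set.range_comp, hfS, Set.image_compl_eq e.bijective, Set.image_singleton]
  · exact e.map_adj_iff.trans (hfA x y)
  · exact e.map_adj_iff.trans (hfM x)

/-- A rooted graph is determined by the marked graph obtained by deleting its root. -/
theorem Realize.nonempty_iso {G' : SimpleGraph W} {r : V} {r' : W}
    (h : Realize A G {r}ᶜ {x | G.Adj x r}) (h' : Realize A G' {r'}ᶜ {x | G'.Adj x r'}) :
    Nonempty (G ≃g G') := by
  obtain ⟨f, hf, hfS, hfA, hfM⟩ := h
  obtain ⟨g, hg, hgS, hgA, hgM⟩ := h'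
  have hfr : ∀ x, f x ≠ r := fun x => by
    have : f x ∈ ({r}ᶜ : Set V) := hfS ▸ ⟨x, rfl⟩
    exact this
  have hgr : ∀ x, g x ≠ r' := fun x => by
    have : g x ∈ ({r'}ᶜ : Set W) := hgS ▸ ⟨x, rfl⟩
    exact this
  have hfs : ∀ v, v = r ∨ ∃ x, v = f x := fun v => by
    by_cases hv : v = r
    · exact .inl hv
    · have : v ∈ Set.range f := hfS ▸ hv
      obtain ⟨x, rfl⟩ := this
      exact .inr ⟨x, rfl⟩
  have hgs : ∀ v, v = r' ∨ ∃ x, v = g x := fun v => by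
    by_cases hv : v = r'
    · exact .inl hv
    · have : v ∈ Set.range g := hgS ▸ hv
      obtain ⟨x, rfl⟩ := this
      exact .inr ⟨x, rfl⟩
  have key : ∀ v, ∃ w, (v = r → w = r') ∧ ∀ x, v = f x → w = g x := fun v => by
    rcases hfs v with rfl | ⟨x, rfl⟩
    · exact ⟨r', fun _ => rfl, fun x hx => absurd hx.symm (hfr x)⟩
    · exact ⟨g x, fun hx => absurd hx (hfr x), fun y hy => by rw [hf hy]⟩
  choose e he using key
  have her : e r = r' := (he r).1 rfl
  have hef : ∀ x, e (f x) = g x := fun x => (he _).2 x rfl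
  have hb : e.Bijective := by
    refine ⟨?_, ?_⟩
    · intro v w hvw
      rcases hfs v with rfl | ⟨x, rfl⟩ <;> rcases hfs w with rfl | ⟨y, rfl⟩
      · rfl
      · rw [her, hef] at hvw; exact absurd hvw.symm (hgr y)
      · rw [her, hef] at hvw; exact absurd hvw (hgr x)
      · rw [hef, hef] at hvw; rw [hg hvw]
    · intro w
      rcases hgs w with rfl | ⟨x, rfl⟩
      · exact ⟨r, her⟩
      · exact ⟨f x, hef x⟩
  refine ⟨⟨Equiv.ofBijective e hb, fun {v w} => ?_⟩⟩
  · simp only [Equiv.ofBijective_apply]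
    have h1 : ∀ x, G'.Adj (g x) r' ↔ G.Adj (f x) r := fun x => (hgM x).trans (hfM x).symm
    rcases hfs v with rfl | ⟨x, rfl⟩ <;> rcases hfs w with rfl | ⟨y, rfl⟩
    · simp
    · rw [her, hef, G'.adj_comm, G.adj_comm, h1]
    · rw [her, hef, h1]
    · rw [hef, hef, hgA, hfA]

theorem Dec.exists_realize (h : Dec G S M) : ∃ t : BT, Realize t.mg G S M := by
  induction h with
  | leaf x =>
    refine ⟨.leaf, fun _ => x, fun _ _ _ => rfl, Set.range_const, fun _ _ => ?_, fun _ => ?_⟩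
    · exact iff_of_false (G.loopless.irrefl x) fun h => h
    · exact iff_of_true rfl trivial
  | @node S₁ M₁ S₂ M₂ S M c h₁ h₂ hd hadj hS hM ih₁ ih₂ =>
    obtain ⟨a, f, hf, hfS, hfA, hfM⟩ := ih₁
    obtain ⟨b, g, hg, hgS, hgA, hgM⟩ := ih₂
    rw [Set.disjoint_left] at hd
    have hfS' : ∀ x, f x ∈ S₁ := fun x => hfS ▸ ⟨x, rfl⟩
    have hgS' : ∀ x, g x ∈ S₂ := fun x => hgS ▸ ⟨x, rfl⟩
    have hfg : ∀ x y, f x ≠ g y := fun x y h => hd (hfS' x) (h ▸ hgS' y)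
    refine ⟨.node c a b, (Sum.elim f g : a.mg.V ⊕ b.mg.V → V), hf.sumElim hg hfg,
      (Set.Sum.elim_range f g).trans ?_, ?_, ?_⟩
    · ext x
      rw [hS, ← hfS, ← hgS]
      rfl
    · have key : ∀ x y, G.Adj (f x) (g y) ↔ c ≠ Op.U ∧ a.mg.M x ∧ b.mg.M y := fun x y => by
        rw [hadj _ (hfS' x) _ (hgS' y), hfM, hgM]
      rintro (x | x) (y | y)
      · exact hfA x y
      · exact key x y
      · exact (G.adj_comm _ _).trans (key y x)
      · exact hgA x y
    · rintro (x | x)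
      · refine (hM _).trans (Iff.trans ⟨fun h => h.resolve_right fun h => ?_, .inl⟩ (hfM x))
        exact hd (hfS' x) (h₂.subset h.2)
      · refine (hM _).trans (Iff.trans ⟨fun h => h.resolve_left fun h => ?_, .inr⟩
          (and_congr_right fun _ => hgM x))
        exact hd (h₁.subset h) (hgS' x)

theorem Realize.dec {t : BT} (h : Realize t.mg G S M) (hMS : M ⊆ S) : Dec G S M := by
  induction t generalizing S M with
  | leaf =>
    obtain ⟨f, -, hfS, -, hfM⟩ := h
    have hS : S = {f ()} := by
      rw [← hfS]
      ext v
      exact ⟨fun ⟨x, hx⟩ => hx.symm, fun hv => ⟨(), hv.symm⟩⟩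
    have hM : M = {f ()} := by
      refine Set.Subset.antisymm (hS ▸ hMS) ?_
      rintro v rfl
      exact (hfM ()).2 trivial
    rw [hS, hM]
    exact .leaf _
  | node c a b iha ihb =>
    obtain ⟨f, hf, hfS, hfA, hfM⟩ := h
    let f₁ : a.mg.V → V := fun x => f (Sum.inl x)
    let f₂ : b.mg.V → V := fun x => f (Sum.inr x)
    have hf₁ : f₁.Injective := fun x y h => Sum.inl_injective (hf h)
    have hf₂ : f₂.Injective := fun x y h => Sum.inr_injective (hf h)
    have h₁ : Dec G (Set.range f₁) (f₁ '' {x | a.mg.M x}) :=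
      iha ⟨f₁, hf₁, rfl, fun x y => hfA (Sum.inl x) (Sum.inl y),
        fun x => hf₁.mem_set_image⟩ (Set.image_subset_range _ _)
    have h₂ : Dec G (Set.range f₂) (f₂ '' {x | b.mg.M x}) :=
      ihb ⟨f₂, hf₂, rfl, fun x y => hfA (Sum.inr x) (Sum.inr y),
        fun x => hf₂.mem_set_image⟩ (Set.image_subset_range _ _)
    have hS : ∀ x, x ∈ S ↔ x ∈ Set.range f₁ ∨ x ∈ Set.range f₂ := fun v => by
      rw [← hfS]
      constructor
      · rintro ⟨x | x, rfl⟩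
        · exact .inl ⟨x, rfl⟩
        · exact .inr ⟨x, rfl⟩
      · rintro (⟨x, rfl⟩ | ⟨x, rfl⟩)
        · exact ⟨Sum.inl x, rfl⟩
        · exact ⟨Sum.inr x, rfl⟩
    refine .node c h₁ h₂ ?_ ?_ hS ?_
    · rw [Set.disjoint_left]
      rintro _ ⟨x, rfl⟩ ⟨y, hy⟩
      exact Sum.inr_ne_inl (hf hy)
    · rintro _ ⟨x, rfl⟩ _ ⟨y, rfl⟩
      rw [hf₁.mem_set_image, hf₂.mem_set_image]
      exact hfA (Sum.inl x) (Sum.inr y)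
    · intro v
      have h1 : ∀ x, f₁ x ∈ M ↔ a.mg.M x := fun x => hfM (Sum.inl x)
      have h2 : ∀ x, f₂ x ∈ M ↔ c ≠ .X ∧ b.mg.M x := fun x => hfM (Sum.inr x)
      constructor
      · intro hv
        rcases (hS v).1 (hMS hv) with ⟨x, rfl⟩ | ⟨x, rfl⟩
        · exact .inl ⟨x, (h1 x).1 hv, rfl⟩
        · exact .inr ⟨((h2 x).1 hv).1, x, ((h2 x).1 hv).2, rfl⟩
      · rintro (⟨x, hx, rfl⟩ | ⟨hc, x, hx, rfl⟩)
        · exact (h1 x).2 hx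
        · exact (h2 x).2 ⟨hc, hx⟩

theorem Realize.connected_and_distanceHereditary [Finite V] {t : BT} {r : V}
    (h : Realize t.mg G {r}ᶜ {x | G.Adj x r}) : G.Connected ∧ DistanceHereditary G := by
  have h1 := (h.dec fun x hx => G.ne_of_adj hx).conn_and_dhOn (r := r) (by simp)
    fun x _ => Iff.rfl
  have h2 : insert r ({r}ᶜ : Set V) = Set.univ := by
    ext x
    simp [em]
  rw [h2] at h1
  have : Nonempty V := ⟨r⟩
  exact ⟨⟨conn_univ_iff.1 h1.1⟩, distanceHereditary_iff.2 h1.2⟩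

theorem exists_realize_of_connected [Finite V] [Nontrivial V] (hG : G.Connected)
    (hd : DistanceHereditary G) (r : V) :
    ∃ t : BT, Realize t.mg G {r}ᶜ {x | G.Adj x r} := by
  obtain ⟨p, hp⟩ := exists_ne r
  have h := ((distanceHereditary_iff.1 hd).dec (conn_univ_iff.2 hG.preconnected) (Set.mem_univ r)
    (Set.mem_univ p) hp).exists_realize
  obtain ⟨t, ht⟩ := h
  refine ⟨t, ?_⟩
  convert ht using 1
  · ext x; simp
  · ext x; simp

end

theorem Realize.size {n : ℕ} {t : BT} {G : SimpleGraph (Fin n)} {r : Fin n} {M : Set (Fin n)}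
    (h : Realize t.mg G {r}ᶜ M) : t.size + 1 = n := by
  obtain ⟨f, hf, hfS, -⟩ := h
  have h1 : Nat.card t.mg.V = Nat.card ({r}ᶜ : Set (Fin n)) := by
    rw [← hfS]
    exact Nat.card_congr (Equiv.ofInjective f hf)
  have h2 := Set.ncard_add_ncard_compl ({r} : Set (Fin n))
  rw [Set.ncard_singleton, Nat.card_fin] at h2
  rw [← t.card_V, h1, Nat.card_coe_set_eq]
  omega

theorem exists_realize (t : BT) {n : ℕ} (hn : t.size + 1 = n) :
    ∃ (G : SimpleGraph (Fin n)) (r : Fin n), Realize t.mg G {r}ᶜ {x | G.Adj x r} := by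
  have hc : Nat.card (Option t.mg.V) = n := by rw [Finite.card_option, t.card_V, hn]
  let e : Option t.mg.V ≃ Fin n := Finite.equivFinOfCardEq hc
  let H : SimpleGraph (Option t.mg.V) :=
    { Adj := fun x y => match x, y with
        | none, none => False
        | none, some y => t.mg.M y
        | some x, none => t.mg.M x
        | some x, some y => t.mg.G.Adj x y
      symm := ⟨by
        rintro (_ | x) (_ | y) h
        · exact h
        · exact h
        · exact h
        · exact t.mg.G.adj_symm h⟩
      loopless := ⟨by
        rintro (_ | x) h
        · exact h
        · exact t.mg.G.loopless.irrefl x h⟩ }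
  refine ⟨H.map e.toEmbedding, e none, Realize.map (SimpleGraph.Iso.map e H)
    ⟨some, Option.some_injective _, ?_, fun x y => Iff.rfl, fun x => Iff.rfl⟩⟩
  ext (_ | x) <;> simp

/-- The connected distance-hereditary graphs on `n` vertices. -/
abbrev ConnDH (n : ℕ) := {G : SimpleGraph (Fin n) // G.Connected ∧ DistanceHereditary G}

/-- The isomorphism classes of connected distance-hereditary graphs on `n` vertices. -/
abbrev ConnDHClass (n : ℕ) :=
  Quot (fun (G G' : ConnDH n) => Nonempty (G.val ≃g G'.val))

theorem ConnDHClass.nonempty_iso {n : ℕ} {G G' : ConnDH n}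
    (h : (Quot.mk _ G : ConnDHClass n) = Quot.mk _ G') : Nonempty (G.val ≃g G'.val) := by
  have h1 := Quot.eqvGen_exact h
  clear h
  induction h1 with
  | rel _ _ h => exact h
  | refl _ => exact ⟨.refl⟩
  | symm _ _ _ ih => exact ⟨ih.some.symm⟩
  | trans _ _ _ _ _ ih ih' => exact ⟨ih.some.trans ih'.some⟩

namespace Cl

/-- The classes with `n` vertices. -/
noncomputable def ofSize (n : ℕ) : Finset Cl :=
  ((finite_size_le n).subset fun _ h => le_of_eq h : {t : Cl | t.size = n}.Finite).toFinset

@[simp] theorem mem_ofSize {n : ℕ} {t : Cl} : t ∈ ofSize n ↔ t.size = n := by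
  simp [ofSize]

end Cl

theorem numConnDH_le {n : ℕ} (hn : 1 ≤ n) : numConnDH (n + 1) ≤ (Cl.ofSize n).card := by
  have : Nontrivial (Fin (n + 1)) := Fin.nontrivial_iff_two_le.2 (by omega)
  have key : ∀ q : ConnDHClass (n + 1), ∃ t : BT,
      Realize t.mg q.out.val {0}ᶜ {x | q.out.val.Adj x 0} := fun q =>
    exists_realize_of_connected q.out.2.1 q.out.2.2 0
  choose t ht using key
  have h1 : ∀ q, Cl.mk (t q) ∈ Cl.ofSize n := fun q => by
    have := (ht q).size
    exact Cl.mem_ofSize.2 (Nat.succ_injective this)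
  have h2 : Function.Injective fun q => (⟨Cl.mk (t q), h1 q⟩ : Cl.ofSize n) := fun q q' h => by
    have h3 : (t q).mg.Iso (t q').mg := Quotient.exact (congrArg Subtype.val h)
    rw [← Quot.out_eq q, ← Quot.out_eq q']
    exact Quot.sound ((ht q).nonempty_iso ((ht q').congr h3))
  have := Nat.card_le_card_of_injective _ h2
  rwa [Nat.card_eq_finsetCard] at this

theorem card_ofSize_le (n : ℕ) : (Cl.ofSize n).card ≤ numConnDH (n + 1) * (n + 1) := by
  have key : ∀ a : Cl.ofSize n, ∃ (q : ConnDHClass (n + 1)) (r : Fin (n + 1)) (t : BT),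
      Cl.mk t = a ∧ Realize t.mg q.out.val {r}ᶜ {x | q.out.val.Adj x r} := by
    rintro ⟨a, ha⟩
    obtain ⟨t, rfl⟩ := Cl.exists_mk a
    obtain ⟨G, r, h⟩ := exists_realize t (congrArg (· + 1) (Cl.mem_ofSize.1 ha))
    let q : ConnDHClass (n + 1) := Quot.mk _ ⟨G, h.connected_and_distanceHereditary⟩
    obtain ⟨e⟩ : Nonempty (G ≃g q.out.val) := ConnDHClass.nonempty_iso (Quot.out_eq q).symm
    exact ⟨q, e r, t, rfl, h.map e⟩
  choose q r t ht h using key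
  have h2 : Function.Injective fun a => (q a, r a) := fun a a' haa => by
    obtain ⟨hq, hr⟩ := Prod.mk.inj haa
    have h' := h a'
    rw [← hq, ← hr] at h'
    apply Subtype.ext
    rw [← ht a, ← ht a']
    exact Quotient.sound ((h a).iso h')
  have := Nat.card_le_card_of_injective _ h2
  rwa [Nat.card_eq_finsetCard, Nat.card_prod, Nat.card_fin] at this

end DistHered

namespace DistHered

/-- The multisets with elements in `F`, split according to the multiplicity of `a`. -/
noncomputable def multisetEquiv {α : Type*} [DecidableEq α] (F : Finset α) {a : α} (ha : a ∉ F) :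
    {s : Multiset α // ∀ p ∈ s, p ∈ insert a F} ≃ ℕ × {s : Multiset α // ∀ p ∈ s, p ∈ F} where
  toFun s := (s.1.count a, ⟨s.1.filter (· ≠ a), fun p hp => by
    rw [Multiset.mem_filter] at hp
    exact (Finset.mem_insert.1 (s.2 p hp.1)).resolve_left hp.2⟩)
  invFun x := ⟨Multiset.replicate x.1 a + x.2.1, fun p hp => by
    rcases Multiset.mem_add.1 hp with h | h
    · exact Finset.mem_insert.2 (.inl (Multiset.eq_of_mem_replicate h))
    · exact Finset.mem_insert.2 (.inr (x.2.2 p h))⟩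
  left_inv := by
    rintro ⟨s, hs⟩
    apply Subtype.ext
    simp only
    rw [← Multiset.filter_eq', Multiset.filter_add_not]
  right_inv := by
    rintro ⟨k, s, hs⟩
    have has : a ∉ s := fun h => ha (hs a h)
    refine Prod.ext ?_ (Subtype.ext ?_)
    · simp [Multiset.count_eq_zero_of_notMem has]
    · simp only [Multiset.filter_add]
      rw [Multiset.filter_eq_nil.2, zero_add, Multiset.filter_eq_self.2]
      · rintro p hp rfl; exact has hp
      · intro p hp; simpa using Multiset.eq_of_mem_replicate hp

/-- The generating function of multisets with elements in a finite set. -/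
theorem hasSum_multiset {α : Type*} (F : Finset α) (w : α → ℝ)
    (h0 : ∀ a ∈ F, 0 ≤ w a) (h1 : ∀ a ∈ F, w a < 1) :
    HasSum (fun s : {s : Multiset α // ∀ p ∈ s, p ∈ F} => (s.1.map w).prod)
      (∏ a ∈ F, (1 - w a)⁻¹) := by
  classical
  induction F using Finset.induction_on with
  | empty =>
    have : Unique {s : Multiset α // ∀ p ∈ s, p ∈ (∅ : Finset α)} :=
      ⟨⟨⟨0, by simp⟩⟩, fun s => Subtype.ext
        (Multiset.eq_zero_of_forall_notMem fun p hp => by simpa using s.2 p hp)⟩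
    convert hasSum_unique _ using 1
    rw [show (default : {s : Multiset α // ∀ p ∈ s, p ∈ (∅ : Finset α)}).1 = 0 from
      congrArg Subtype.val (this.uniq ⟨0, by simp⟩).symm]
    simp
  | insert a F ha ih =>
    have ih := ih (fun b hb => h0 b (Finset.mem_insert_of_mem hb))
      fun b hb => h1 b (Finset.mem_insert_of_mem hb)
    have ha0 := h0 a (Finset.mem_insert_self a F)
    have hg := hasSum_geometric_of_lt_one ha0 (h1 a (Finset.mem_insert_self a F))
    rw [Finset.prod_insert ha]
    have hs : ∀ s : {s : Multiset α // ∀ p ∈ s, p ∈ F}, 0 ≤ (s.1.map w).prod := fun s =>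
      Multiset.prod_nonneg fun x hx => by
        obtain ⟨p, hp, rfl⟩ := Multiset.mem_map.1 hx
        exact h0 p (Finset.mem_insert_of_mem (s.2 p hp))
    have hm := hg.mul ih (hg.summable.mul_of_nonneg ih.summable
      (fun k => pow_nonneg ha0 k) hs)
    rw [← (multisetEquiv F ha).symm.hasSum_iff]
    refine (congrArg (HasSum · _) (funext fun x => ?_)).mpr hm
    change ((Multiset.replicate x.1 a + x.2.1).map w).prod = _
    simp

theorem hasSum_indicator_multiset {α : Type*} (F : Finset α) (w : α → ℝ)
    (h0 : ∀ a ∈ F, 0 ≤ w a) (h1 : ∀ a ∈ F, w a < 1) :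
    HasSum ({s : Multiset α | ∀ p ∈ s, p ∈ F}.indicator fun s => (s.map w).prod)
      (∏ a ∈ F, (1 - w a)⁻¹) :=
  (hasSum_subtype_iff_indicator (f := fun s : Multiset α => (s.map w).prod)
    (s := {s : Multiset α | ∀ p ∈ s, p ∈ F})).1 (hasSum_multiset F w h0 h1)

end DistHered

namespace DistHered

theorem sum_le_sum_of_injOn {α β : Type*} {s : Finset α} {t : Finset β} {f : α → ℝ} {g : β → ℝ}
    (i : α → β) (hi : ∀ a ∈ s, i a ∈ t) (hinj : Set.InjOn i s) (h : ∀ a ∈ s, f a = g (i a))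
    (hg : ∀ b ∈ t, 0 ≤ g b) : ∑ a ∈ s, f a ≤ ∑ b ∈ t, g b := by
  classical
  calc ∑ a ∈ s, f a = ∑ a ∈ s, g (i a) := Finset.sum_congr rfl h
    _ = ∑ b ∈ s.image i, g b := (Finset.sum_image hinj).symm
    _ ≤ ∑ b ∈ t, g b := Finset.sum_le_sum_of_subset_of_nonneg
        (Finset.image_subset_iff.2 hi) fun b hb _ => hg b hb

namespace Cl

/-- The classes with at most `N` vertices. -/
noncomputable def upTo (N : ℕ) : Finset Cl := (finite_size_le N).toFinset

@[simp] theorem mem_upTo {N : ℕ} {t : Cl} : t ∈ upTo N ↔ t.size ≤ N := by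
  simp [upTo]

/-- The components of a class. -/
noncomputable def components (t : Cl) : Multiset Cl := t.exists_union.choose

theorem not_isOp_union_of_mem_components {t p : Cl} (hp : p ∈ t.components) : ¬ p.IsOp .U :=
  t.exists_union.choose_spec.1 p hp

theorem union_components (t : Cl) : union t.components = t := t.exists_union.choose_spec.2

theorem components_injective : Function.Injective components := fun t t' h => by
  rw [← WithZero.coe_inj, ← union_components, h, union_components]

theorem components_ne_zero (t : Cl) : t.components ≠ 0 := fun h => by
  have := t.union_components
  rw [h, union_zero] at this
  exact WithZero.coe_ne_zero this.symm

theorem size_le_of_mem_components {t p : Cl} (hp : p ∈ t.components) : p.size ≤ t.size := by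
  rw [← size_union t.union_components]
  exact Multiset.single_le_sum (fun _ _ => Nat.zero_le _) _ (Multiset.mem_map_of_mem _ hp)

theorem size_lt_of_mem_components {t p : Cl} (ht : t.IsOp .U) (hp : p ∈ t.components) :
    p.size < t.size := by
  have hne : t.components ≠ {p} := fun h => by
    have h1 := t.union_components
    rw [h, union_singleton, WithZero.coe_inj] at h1
    exact not_isOp_union_of_mem_components hp (h1 ▸ ht)
  obtain ⟨s, hs⟩ := Multiset.exists_cons_of_mem hp
  have hs0 : s ≠ 0 := by
    rintro rfl
    exact hne hs
  obtain ⟨q, hq⟩ := Multiset.exists_mem_of_ne_zero hs0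
  have h2 := size_union t.union_components
  rw [hs, Multiset.map_cons, Multiset.sum_cons] at h2
  have h3 : q.size ≤ (s.map size).sum :=
    Multiset.single_le_sum (fun _ _ => Nat.zero_le _) _ (Multiset.mem_map_of_mem _ hq)
  have := q.size_pos
  omega

theorem prod_map_pow_size (y : ℝ) {s : Multiset Cl} {t : Cl} (h : union s = t) :
    (s.map fun p => y ^ p.size).prod = y ^ t.size := by
  rw [← size_union h]
  clear h
  induction s using Multiset.induction_on with
  | empty => simp
  | cons a s ih => simp [pow_add, ih]

/-- The nontrivial classes which are not disjoint unions. -/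
def IsRest (t : Cl) : Prop := ¬ t.IsOp .U ∧ t ≠ leaf

theorem IsRest.two_le_size {t : Cl} (h : t.IsRest) : 2 ≤ t.size := by
  have h1 := t.size_pos
  have h2 : t.size ≠ 1 := fun h' => h.2 (eq_leaf_of_size h')
  omega

theorem IsRest.isOp {t : Cl} (h : t.IsRest) : t.IsOp .K ∨ t.IsOp .X := by
  rcases t.eq_leaf_or_node with h' | ⟨c, a, b, rfl⟩
  · exact absurd h' h.2
  · cases c
    · exact absurd ⟨a, b, rfl⟩ h.1
    · exact .inl ⟨a, b, rfl⟩
    · exact .inr ⟨a, b, rfl⟩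

theorem eq_leaf_or_isOp {t : Cl} (h : ¬ t.IsOp .X) : t = leaf ∨ t.IsOp .U ∨ t.IsOp .K := by
  rcases t.eq_leaf_or_node with h' | ⟨c, a, b, rfl⟩
  · exact .inl h'
  · cases c
    · exact .inr (.inl ⟨a, b, rfl⟩)
    · exact .inr (.inr ⟨a, b, rfl⟩)
    · exact absurd ⟨a, b, rfl⟩ h

open Classical in
/-- The truncated generating function of the classes satisfying `p`. -/
noncomputable def gs (p : Cl → Prop) (N : ℕ) (y : ℝ) : ℝ := ∑ t ∈ upTo N with p t, y ^ t.size

section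

variable {p q r : Cl → Prop} {N : ℕ} {y : ℝ}

theorem gs_nonneg (hy : 0 ≤ y) : 0 ≤ gs p N y :=
  Finset.sum_nonneg fun _ _ => pow_nonneg hy _

theorem gs_le_add (hy : 0 ≤ y) (h : ∀ t, r t → p t ∨ q t) : gs r N y ≤ gs p N y + gs q N y := by
  classical
  simp only [gs, Finset.sum_filter]
  rw [← Finset.sum_add_distrib]
  refine Finset.sum_le_sum fun t _ => ?_
  have h0 := pow_nonneg hy t.size
  have := h t
  split_ifs <;> first | linarith | tauto

theorem gs_leaf_le (hy : 0 ≤ y) : gs (· = leaf) N y ≤ y := by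
  classical
  refine (Finset.sum_le_sum_of_subset_of_nonneg (t := {leaf}) (fun t ht => ?_)
    fun t _ _ => pow_nonneg hy _).trans (by simp)
  exact Finset.mem_singleton.2 (Finset.mem_filter.1 ht).2

theorem gs_le_add_rest_add_union (hy : 0 ≤ y) :
    gs p N y ≤ y + gs IsRest N y + gs (IsOp .U) N y := by
  have h1 : gs p N y ≤ gs (· = leaf) N y + gs (fun t => t ≠ leaf) N y :=
    gs_le_add hy fun t _ => em _
  have h2 : gs (fun t => t ≠ leaf) N y ≤ gs IsRest N y + gs (IsOp .U) N y :=
    gs_le_add hy fun t ht => by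
      by_cases hU : t.IsOp .U
      · exact .inr hU
      · exact .inl ⟨hU, ht⟩
  have h3 := gs_leaf_le (N := N) hy
  linarith

theorem gs_join_le (hy : 0 ≤ y) : gs (IsOp .K) N y ≤ gs (IsOp .U) N y := by
  classical
  refine sum_le_sum_of_injOn dual (fun t ht => ?_) (fun t _ t' _ h => ?_) (fun t _ => ?_)
    fun t _ => pow_nonneg hy _
  · rw [Finset.mem_filter, mem_upTo] at ht ⊢
    exact ⟨by rw [size_dual]; exact ht.1, isOp_union_dual.2 ht.2⟩
  · rw [← dual_dual t, h, dual_dual]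
  · rw [size_dual]

theorem gs_attach_le (hy : 0 ≤ y) :
    gs (IsOp .X) (N + 1) y ≤ gs (fun t => ¬ t.IsOp .X) N y * gs (fun _ => True) N y := by
  classical
  have key : ∀ t : Cl, ∃ x : Cl × Cl, t.IsOp .X → ¬ x.1.IsOp .X ∧ t = node .X x.1 x.2 := fun t => by
    by_cases ht : t.IsOp .X
    · obtain ⟨a, b, h⟩ := exists_attach ht
      exact ⟨(a, b), fun _ => h⟩
    · exact ⟨(t, t), fun h => absurd h ht⟩
  choose i hi using key
  rw [gs, gs, gs, Finset.sum_mul_sum, ← Finset.sum_product']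
  refine sum_le_sum_of_injOn i (fun t ht => ?_) (fun t ht t' ht' h => ?_) (fun t ht => ?_)
    fun t _ => mul_nonneg (pow_nonneg hy _) (pow_nonneg hy _)
  · obtain ⟨h1, h2⟩ := Finset.mem_filter.1 ht
    obtain ⟨h3, h4⟩ := hi t h2
    have h5 := congrArg size h4
    have h6 := (i t).1.size_pos
    have h7 := (i t).2.size_pos
    rw [mem_upTo] at h1
    rw [size_node] at h5
    simp only [Finset.mem_product, Finset.mem_filter, mem_upTo, and_true]
    exact ⟨⟨by omega, h3⟩, by omega⟩
  · rw [(hi t (Finset.mem_filter.1 ht).2).2, (hi t' (Finset.mem_filter.1 ht').2).2, h]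
  · conv_lhs => rw [(hi t (Finset.mem_filter.1 ht).2).2]
    rw [size_node, pow_add]

theorem one_add_sum_le (hy : 0 ≤ y) (hy1 : y < 1) (F S : Finset Cl)
    (h : ∀ t ∈ S, ∀ p ∈ t.components, p ∈ F) :
    1 + ∑ t ∈ S, y ^ t.size ≤ ∏ t ∈ F, (1 - y ^ t.size)⁻¹ := by
  classical
  have h1 := hasSum_indicator_multiset F (fun t => y ^ t.size) (fun t _ => pow_nonneg hy _)
    fun t _ => pow_lt_one₀ hy hy1 t.size_pos.ne'
  refine le_trans (le_of_eq ?_) (sum_le_hasSum (insert 0 (S.image components)) (fun s _ => ?_) h1)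
  · rw [Finset.sum_insert, Finset.sum_image components_injective.injOn]
    · have h2 : ∀ s : Multiset Cl, (∀ p ∈ s, p ∈ F) → {s : Multiset Cl | ∀ p ∈ s, p ∈ F}.indicator
          (fun s => (s.map fun p => y ^ p.size).prod) s = (s.map fun p => y ^ p.size).prod :=
        fun s hs => Set.indicator_of_mem (Set.mem_ofPred_eq.mpr hs) _
      rw [h2 0 (by simp), Multiset.map_zero, Multiset.prod_zero]
      refine congrArg (1 + ·) (Finset.sum_congr rfl fun t ht => ?_)
      rw [h2 _ (h t ht), prod_map_pow_size y t.union_components]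
    · rw [Finset.mem_image]
      rintro ⟨t, -, ht⟩
      exact t.components_ne_zero ht
  · refine Set.indicator_nonneg (fun s _ => Multiset.prod_nonneg fun x hx => ?_) s
    obtain ⟨p, -, rfl⟩ := Multiset.mem_map.1 hx
    exact pow_nonneg hy _

open Classical in
theorem one_add_gs_le (hy : 0 ≤ y) (hy1 : y < 1) (hN : 1 ≤ N) :
    1 + (y + gs IsRest N y + gs (IsOp .U) (N + 1) y) ≤
      (1 - y)⁻¹ * ∏ t ∈ upTo N with IsRest t, (1 - y ^ t.size)⁻¹ := by
  obtain ⟨F, hF⟩ : ∃ F : Finset Cl, F = {t ∈ upTo N | IsRest t} := ⟨_, rfl⟩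
  obtain ⟨S, hS⟩ : ∃ S : Finset Cl, S = {t ∈ upTo (N + 1) | IsOp .U t} := ⟨_, rfl⟩
  have hFm : ∀ t, t ∈ F ↔ t.size ≤ N ∧ t.IsRest := fun t => by
    rw [hF, Finset.mem_filter, mem_upTo]
  have hSm : ∀ t, t ∈ S ↔ t.size ≤ N + 1 ∧ t.IsOp .U := fun t => by
    rw [hS, Finset.mem_filter, mem_upTo]
  have hl : leaf ∉ F := fun h => ((hFm _).1 h).2.2 rfl
  have hdisj : Disjoint (insert leaf F) S := by
    rw [Finset.disjoint_left]
    intro t ht ht'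
    rcases Finset.mem_insert.1 ht with rfl | h
    · exact not_isOp_leaf _ ((hSm _).1 ht').2
    · exact ((hFm _).1 h).2.1 ((hSm _).1 ht').2
  have h2 := one_add_sum_le hy hy1 (insert leaf F) (insert leaf F ∪ S) ?_
  · rw [Finset.prod_insert hl, size_leaf, pow_one, Finset.sum_union hdisj,
      Finset.sum_insert hl, size_leaf, pow_one] at h2
    rw [gs, gs, ← hF, ← hS]
    exact h2
  · intro t ht p hp
    have h3 := not_isOp_union_of_mem_components hp
    have h4 : p.size ≤ N := by
      have h5 := size_le_of_mem_components hp
      rcases Finset.mem_union.1 ht with h | h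
      · rcases Finset.mem_insert.1 h with rfl | h
        · exact h5.trans hN
        · exact h5.trans ((hFm _).1 h).1
      · have h6 := size_lt_of_mem_components ((hSm _).1 h).2 hp
        have h7 := ((hSm _).1 h).1
        omega
    by_cases hp' : p = leaf
    · exact Finset.mem_insert.2 (.inl hp')
    · exact Finset.mem_insert_of_mem ((hFm _).2 ⟨h4, h3, hp'⟩)

end

end Cl

end DistHered

namespace DistHered

theorem exp_le_inv_one_sub {z : ℝ} (h0 : 0 ≤ z) (h1 : z < 1) :
    Real.exp (z + z ^ 2 / 2 + z ^ 3 / 3) ≤ (1 - z)⁻¹ := by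
  have h := sum_le_hasSum (Finset.range 3) (fun n _ => by positivity)
    (Real.hasSum_pow_div_log_of_abs_lt_one (abs_lt.2 ⟨by linarith, h1⟩))
  rw [← Real.exp_log (inv_pos.2 (sub_pos.2 h1)), Real.log_inv, Real.exp_le_exp]
  norm_num [Finset.sum_range_succ] at h
  linarith

theorem inv_one_sub_le_exp {z m : ℝ} (h0 : 0 ≤ z) (hm : z ≤ m) (h1 : m < 1) :
    (1 - z)⁻¹ ≤ Real.exp (z + z ^ 2 / 2 + (1 / 3 + m / 4 + m ^ 2 / (1 - m)) * z ^ 3) := by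
  have hz : z < 1 := hm.trans_lt h1
  have h := Real.abs_log_sub_add_sum_range_le (x := z) (by rwa [abs_of_nonneg h0]) 4
  rw [abs_of_nonneg h0] at h
  have h2 := (abs_le.1 h).1
  norm_num [Finset.sum_range_succ] at h2
  rw [← Real.exp_log (inv_pos.2 (sub_pos.2 hz)), Real.log_inv, Real.exp_le_exp]
  have h3 : z ^ 5 / (1 - z) ≤ m ^ 2 / (1 - m) * z ^ 3 := by
    rw [div_mul_eq_mul_div, show z ^ 5 = z ^ 2 * z ^ 3 by ring]
    gcongr
  have h4 : z ^ 4 / 4 ≤ m / 4 * z ^ 3 := by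
    rw [show z ^ 4 = z * z ^ 3 by ring, div_mul_eq_mul_div]
    gcongr
  linarith

namespace Cl

variable {N : ℕ} {y : ℝ}

theorem gs_rest_sq_le (hy : 0 ≤ y) (hy1 : y ≤ 1) :
    gs IsRest N (y ^ 2) ≤ y ^ 2 * gs IsRest N y := by
  classical
  rw [gs, gs, Finset.mul_sum]
  refine Finset.sum_le_sum fun t ht => ?_
  rw [← pow_mul, ← pow_add]
  have := (Finset.mem_filter.1 ht).2.two_le_size
  exact pow_le_pow_of_le_one hy hy1 (by omega)

theorem gs_rest_cube_le (hy : 0 ≤ y) (hy1 : y ≤ 1) :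
    gs IsRest N (y ^ 3) ≤ y ^ 4 * gs IsRest N y := by
  classical
  rw [gs, gs, Finset.mul_sum]
  refine Finset.sum_le_sum fun t ht => ?_
  rw [← pow_mul, ← pow_add]
  have := (Finset.mem_filter.1 ht).2.two_le_size
  exact pow_le_pow_of_le_one hy hy1 (by omega)

/-- A bound for `log (1 - z)⁻¹ - z - z ^ 2 / 2` in terms of `z ^ 3` for `z ≤ y ^ 2`. -/
noncomputable def cubeCoeff (y : ℝ) : ℝ := 1 / 3 + y ^ 2 / 4 + (y ^ 2) ^ 2 / (1 - y ^ 2)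

open Classical in
theorem prod_rest_le (hy : 0 ≤ y) (hy1 : y < 1) :
    ∏ t ∈ upTo N with IsRest t, (1 - y ^ t.size)⁻¹ ≤
      Real.exp (gs IsRest N y + gs IsRest N (y ^ 2) / 2 + cubeCoeff y * gs IsRest N (y ^ 3)) := by
  rw [gs, gs, gs, Finset.sum_div, Finset.mul_sum, ← Finset.sum_add_distrib,
    ← Finset.sum_add_distrib, Real.exp_sum]
  refine Finset.prod_le_prod (fun t _ => ?_) fun t ht => ?_
  · exact inv_nonneg.2 (sub_nonneg.2 (pow_le_one₀ hy hy1.le))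
  · have h2 := (Finset.mem_filter.1 ht).2.two_le_size
    have := inv_one_sub_le_exp (pow_nonneg hy t.size) (pow_le_pow_of_le_one hy hy1.le h2)
      (pow_lt_one₀ hy hy1 two_ne_zero)
    refine this.trans (Real.exp_le_exp.2 (le_of_eq ?_))
    rw [cubeCoeff]
    ring

theorem gs_eq_zero {p : Cl → Prop} (h : ∀ t : Cl, p t → N < t.size) : gs p N y = 0 := by
  classical
  rw [gs, Finset.sum_eq_zero]
  intro t ht
  obtain ⟨h1, h2⟩ := Finset.mem_filter.1 ht
  have := mem_upTo.1 h1
  have := h t h2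
  omega

theorem IsOp.two_le_size {c : Op} {t : Cl} (h : t.IsOp c) : 2 ≤ t.size := by
  obtain ⟨a, b, rfl⟩ := h
  have := a.size_pos
  have := b.size_pos
  rw [size_node]
  omega

theorem gs_mono {p : Cl → Prop} {M : ℕ} (hy : 0 ≤ y) (h : N ≤ M) : gs p N y ≤ gs p M y := by
  classical
  refine Finset.sum_le_sum_of_subset_of_nonneg (fun t ht => ?_) fun t _ _ => pow_nonneg hy _
  rw [Finset.mem_filter, mem_upTo] at ht ⊢
  exact ⟨ht.1.trans h, ht.2⟩

/-- A criterion for the boundedness of the truncated generating functions. -/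
theorem gs_bound {p k c : ℝ} (hy : 0 ≤ y) (hy1 : y < 1) (hp : y ≤ p) (hk : 0 ≤ k) (hc0 : 0 ≤ c)
    (hc : ∀ N, gs IsRest N y ≤ p - y →
      gs IsRest N (y ^ 2) / 2 + cubeCoeff y * gs IsRest N (y ^ 3) ≤ c)
    (h1 : Real.exp (p - y + c) ≤ (1 - y) * (1 + p + k)) (h2 : k + (y + 2 * k) * (p + k) ≤ p - y)
    (N : ℕ) : gs IsRest N y ≤ p - y ∧ gs (IsOp .U) N y ≤ k := by
  suffices h : gs IsRest (N + 1) y ≤ p - y ∧ gs (IsOp .U) (N + 1) y ≤ k from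
    ⟨(gs_mono hy N.le_succ).trans h.1, (gs_mono hy N.le_succ).trans h.2⟩
  induction N with
  | zero =>
    rw [gs_eq_zero fun t ht => ht.two_le_size, gs_eq_zero fun t ht => ht.two_le_size]
    exact ⟨sub_nonneg.2 hp, hk⟩
  | succ N ih =>
    obtain ⟨ih1, ih2⟩ := ih
    have hr0 : 0 ≤ gs IsRest (N + 1) y := gs_nonneg hy
    have hu0 : 0 ≤ gs (IsOp .U) (N + 1) y := gs_nonneg hy
    have hU : gs (IsOp .U) (N + 1 + 1) y ≤ k := by
      have e1 := one_add_gs_le hy hy1 (Nat.le_add_left 1 N)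
      have e2 := prod_rest_le (N := N + 1) hy hy1
      have e3 : Real.exp (gs IsRest (N + 1) y + gs IsRest (N + 1) (y ^ 2) / 2 +
          cubeCoeff y * gs IsRest (N + 1) (y ^ 3)) ≤ Real.exp (gs IsRest (N + 1) y + c) :=
        Real.exp_le_exp.2 (by linarith [hc _ ih1])
      set a := gs IsRest (N + 1) y
      have e4 : Real.exp (a + c) * (1 + (p - y - a)) ≤ Real.exp (p - y + c) := by
        rw [show p - y + c = (a + c) + (p - y - a) by ring, Real.exp_add (a + c)]
        have := Real.add_one_le_exp (p - y - a)
        exact mul_le_mul_of_nonneg_left (by linarith) (Real.exp_pos _).le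
      have e5 : 1 ≤ Real.exp (a + c) := Real.one_le_exp (by linarith)
      have e6 : 0 < 1 - y := sub_pos.2 hy1
      have e7 := e1.trans (mul_le_mul_of_nonneg_left (e2.trans e3) (inv_nonneg.2 e6.le))
      rw [inv_mul_eq_div, le_div_iff₀ e6] at e7
      have e8 := mul_nonneg (sub_nonneg.2 e5) (sub_nonneg.2 ih1)
      have e9 : (1 + (y + a + gs (IsOp .U) (N + 1 + 1) y)) * (1 - y) ≤
          (1 - y) * (1 + p + k) - (1 - y) * (p - y - a) := by
        nlinarith [mul_nonneg hy (sub_nonneg.2 ih1)]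
      have e10 := le_of_mul_le_mul_left (by linarith :
        (1 - y) * (1 + (y + a + gs (IsOp .U) (N + 1 + 1) y)) ≤
          (1 - y) * ((1 + p + k) - (p - y - a))) e6
      linarith
    refine ⟨?_, hU⟩
    have e1 : gs IsRest (N + 1 + 1) y ≤ gs (IsOp .K) (N + 1 + 1) y + gs (IsOp .X) (N + 1 + 1) y :=
      gs_le_add hy fun t ht => ht.isOp
    have e2 := (gs_join_le (N := N + 1 + 1) hy).trans hU
    have e3 := gs_attach_le (N := N + 1) hy
    have e4 : gs (fun t => ¬ t.IsOp .X) (N + 1) y ≤ y + 2 * k := by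
      have f1 : gs (fun t => ¬ t.IsOp .X) (N + 1) y ≤
          gs (· = leaf) (N + 1) y + gs (fun t => t.IsOp .U ∨ t.IsOp .K) (N + 1) y :=
        gs_le_add hy fun t ht => eq_leaf_or_isOp ht
      have f2 : gs (fun t => t.IsOp .U ∨ t.IsOp .K) (N + 1) y ≤
          gs (IsOp .U) (N + 1) y + gs (IsOp .K) (N + 1) y := gs_le_add hy fun t ht => ht
      have f3 := gs_leaf_le (N := N + 1) hy
      have f4 := (gs_join_le (N := N + 1) hy)
      linarith
    have e5 : gs (fun _ => True) (N + 1) y ≤ p + k := by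
      have := gs_le_add_rest_add_union (p := fun _ => True) (N := N + 1) hy
      linarith
    have e6 := mul_le_mul e4 e5 (gs_nonneg hy) (by linarith)
    linarith

theorem card_ofSize_mul_le_gs {p : Cl → Prop} (hy : 0 ≤ y) (N : ℕ) (h : ∀ t, p t) :
    (ofSize N).card * y ^ N ≤ gs p N y := by
  classical
  rw [← nsmul_eq_mul, ← Finset.sum_const]
  refine (Finset.sum_congr rfl fun t ht => ?_).trans_le
    (Finset.sum_le_sum_of_subset_of_nonneg (fun t ht => ?_) fun t _ _ => pow_nonneg hy _)
  · rw [mem_ofSize.1 ht]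
  · rw [Finset.mem_filter, mem_upTo]
    exact ⟨(mem_ofSize.1 ht).le, h t⟩

theorem card_ofSize_mul_le {C : ℝ} (hy : 0 ≤ y) (N : ℕ)
    (h : gs IsRest N y + gs (IsOp .U) N y ≤ C) : (ofSize N).card * y ^ N ≤ y + C := by
  have f1 := gs_le_add_rest_add_union (p := fun _ => True) (N := N) hy
  have f2 := card_ofSize_mul_le_gs (p := fun _ => True) hy N fun _ => trivial
  linarith

end Cl

end DistHered

namespace DistHered

theorem exp_le_of_taylor {e r : ℝ} (h0 : 0 ≤ e) (h1 : e ≤ 1)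
    (h : 1 + e + e ^ 2 / 2 + e ^ 3 / 6 + e ^ 4 / 24 + e ^ 5 / 120 + e ^ 6 / 720 +
      e ^ 7 / 4410 ≤ r) :
    Real.exp e ≤ r := by
  refine (Real.exp_bound' h0 h1 (n := 7) (by norm_num)).trans (le_trans (le_of_eq ?_) h)
  norm_num [Finset.sum_range_succ, Nat.factorial]
  ring

namespace Cl

theorem gs_bound_crude {y p k c e : ℝ} (hy : 0 ≤ y) (hy1 : y ≤ 1 / 2) (hp : y ≤ p) (hk : 0 ≤ k)
    (hc : (y ^ 2 / 2 + y ^ 4) * (p - y) ≤ c) (he : p - y + c ≤ e)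
    (h1 : Real.exp e ≤ (1 - y) * (1 + p + k)) (h2 : k + (y + 2 * k) * (p + k) ≤ p - y)
    (N : ℕ) : gs IsRest N y ≤ p - y := by
  have hc0 : 0 ≤ c := le_trans (mul_nonneg (by positivity) (sub_nonneg.2 hp)) hc
  refine (gs_bound hy (by linarith) hp hk hc0 (fun N h => ?_)
    ((Real.exp_le_exp.2 he).trans h1) h2 N).1
  have e1 := gs_rest_sq_le (N := N) hy (by linarith)
  have e2 := gs_rest_cube_le (N := N) hy (by linarith)
  have e3 : cubeCoeff y ≤ 1 := by
    have h3 : y ^ 2 ≤ 1 / 4 := by nlinarith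
    have h4 : (y ^ 2) ^ 2 / (1 - y ^ 2) ≤ 1 / 4 := by
      rw [div_le_iff₀ (by linarith)]
      nlinarith [sq_nonneg y]
    rw [cubeCoeff]
    linarith
  have e4 : 0 ≤ gs IsRest N (y ^ 3) := gs_nonneg (by positivity)
  have e5 := mul_le_mul_of_nonneg_right e3 e4
  have e6 : (y ^ 2 / 2 + y ^ 4) * gs IsRest N y ≤ (y ^ 2 / 2 + y ^ 4) * (p - y) :=
    mul_le_mul_of_nonneg_left h (by positivity)
  linarith

theorem card_ofSize_le_pow (N : ℕ) : ((ofSize N).card : ℝ) ≤ 7.2498 ^ N := by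
  obtain ⟨x, hx⟩ : ∃ x : ℝ, x = 5000 / 36249 := ⟨_, rfl⟩
  have hb2 : ∀ N, gs IsRest N (x ^ 2) ≤ 0.01981050288 - x ^ 2 :=
    gs_bound_crude (k := 0.00038470952) (c := 0.0000001421) (e := 0.00078462501) (by positivity)
      (by norm_num [hx]) (by norm_num [hx]) (by norm_num) (by norm_num [hx]) (by norm_num [hx])
      (exp_le_of_taylor (by norm_num) (by norm_num) (by norm_num [hx])) (by norm_num [hx])
  have hb3 : ∀ N, gs IsRest N (x ^ 3) ≤ 0.00263829753 - x ^ 3 :=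
    gs_bound_crude (k := 0.00000696725) (c := 0.0000000001) (e := 0.00001394662) (by positivity)
      (by norm_num [hx]) (by norm_num [hx]) (by norm_num) (by norm_num [hx]) (by norm_num [hx])
      (exp_le_of_taylor (by norm_num) (by norm_num) (by norm_num [hx])) (by norm_num [hx])
  have hx0 : 0 ≤ x := by norm_num [hx]
  have hcc : cubeCoeff x ≤ 0.33847 := by norm_num [cubeCoeff, hx]
  have h := gs_bound (y := x) (p := 0.3003061873) (k := 0.06474629675) (c := 0.000396962)
    hx0 (by norm_num [hx]) (by norm_num [hx]) (by norm_num) (by norm_num) (fun N _ => ?_)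
    ?_ (by norm_num [hx]) N
  · have h1 := card_ofSize_mul_le hx0 N (add_le_add h.1 h.2)
    have h2 : ((ofSize N).card : ℝ) * x ^ N ≤ 1 := h1.trans (by norm_num [hx])
    have h3 : (7.2498 : ℝ) ^ N = (x ^ N)⁻¹ := by
      rw [← inv_pow, hx]
      norm_num
    rw [h3, ← one_div, le_div_iff₀ (by rw [hx]; positivity)]
    exact h2
  · have e1 : 0 ≤ gs IsRest N (x ^ 3) := gs_nonneg (by positivity)
    have e2 := mul_le_mul hcc (hb3 N) e1 (by norm_num)
    have e3 := hb2 N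
    have e4 : (0.01981050288 - x ^ 2) / 2 + 0.33847 * (0.00263829753 - x ^ 3) ≤ 0.000396962 := by
      norm_num [hx]
    linarith
  · exact (Real.exp_le_exp.2 (by norm_num [hx])).trans (exp_le_of_taylor (e := 0.16276831)
      (by norm_num) (by norm_num) (by norm_num [hx]))

end Cl

end DistHered

namespace DistHered

namespace Cl

variable {p q r : Cl → Prop} {N : ℕ} {y : ℝ}

theorem gs_le_gs (hy : 0 ≤ y) (h : ∀ t, p t → q t) : gs p N y ≤ gs q N y := by
  classical
  exact Finset.sum_le_sum_of_subset_of_nonneg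
    (Finset.monotone_filter_right _ fun t _ => h t) fun t _ _ => pow_nonneg hy _

theorem gs_le_gs_left {z : ℝ} (hy : 0 ≤ y) (h : y ≤ z) : gs p N y ≤ gs p N z :=
  Finset.sum_le_sum fun _ _ => pow_le_pow_left₀ hy h _

theorem add_gs_le (hy : 0 ≤ y) (h : ∀ t, p t → r t) (h' : ∀ t, q t → r t)
    (hd : ∀ t, p t → ¬ q t) : gs p N y + gs q N y ≤ gs r N y := by
  classical
  simp only [gs, Finset.sum_filter]
  rw [← Finset.sum_add_distrib]
  refine Finset.sum_le_sum fun t _ => ?_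
  have h0 := pow_nonneg hy t.size
  have h1 := h t
  have h2 := h' t
  have h3 := hd t
  split_ifs <;> first | linarith | tauto

theorem le_gs_leaf (hN : 1 ≤ N) : y ≤ gs (· = leaf) N y := by
  classical
  refine le_of_eq ?_
  rw [gs, Finset.sum_eq_single leaf]
  · simp
  · intro t ht h
    exact absurd (Finset.mem_filter.1 ht).2 h
  · intro h
    exact (h (Finset.mem_filter.2 ⟨mem_upTo.2 hN, rfl⟩)).elim

theorem gs_union_le (hy : 0 ≤ y) : gs (IsOp .U) N y ≤ gs (IsOp .K) N y := by
  classical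
  refine sum_le_sum_of_injOn dual (fun t ht => ?_) (fun t _ t' _ h => ?_) (fun t _ => ?_)
    fun t _ => pow_nonneg hy _
  · rw [Finset.mem_filter, mem_upTo] at ht ⊢
    exact ⟨by rw [size_dual]; exact ht.1, isOp_union_dual.1 (by rw [dual_dual]; exact ht.2)⟩
  · rw [← dual_dual t, h, dual_dual]
  · rw [size_dual]

theorem mul_gs_le (hy : 0 ≤ y) (hp : ∀ t, p t → ¬ t.IsOp .X) :
    gs p N y * gs q N y ≤ gs (IsOp .X) (N + N) y := by
  classical
  rw [gs, gs, gs, Finset.sum_mul_sum, ← Finset.sum_product']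
  refine sum_le_sum_of_injOn (fun x : Cl × Cl => node .X x.1 x.2) (fun x hx => ?_)
    (fun x hx x' hx' h => ?_) (fun x _ => ?_) fun t _ => pow_nonneg hy _
  · simp only [Finset.mem_product, Finset.mem_filter, mem_upTo] at hx ⊢
    exact ⟨by rw [size_node]; omega, x.1, x.2, rfl⟩
  · have h1 := (Finset.mem_filter.1 (Finset.mem_product.1 hx).1).2
    have h2 := (Finset.mem_filter.1 (Finset.mem_product.1 hx').1).2
    exact Prod.ext_iff.2 (attach_injective (hp _ h1) (hp _ h2) h)
  · rw [size_node, pow_add]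

theorem exp_gs_le (hy : 0 ≤ y) (hy1 : y < 1) {C : ℝ} (hC : ∀ N, gs (fun _ => True) N y ≤ C) :
    Real.exp (gs IsRest N y + gs IsRest N (y ^ 2) / 2 + gs IsRest N (y ^ 3) / 3) ≤
      (1 - y) * (1 + C) := by
  classical
  obtain ⟨F, hF⟩ : ∃ F : Finset Cl, F = {t ∈ upTo N | IsRest t} := ⟨_, rfl⟩
  have hl : leaf ∉ F := fun h => (Finset.mem_filter.1 (hF ▸ h)).2.2 rfl
  have hU : ∀ t ∈ insert leaf F, ¬ t.IsOp .U := fun t ht => by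
    rcases Finset.mem_insert.1 ht with rfl | h
    · exact not_isOp_leaf _
    · exact (Finset.mem_filter.1 (hF ▸ h)).2.1
  have h1 := hasSum_multiset (insert leaf F) (fun t => y ^ t.size) (fun t _ => pow_nonneg hy _)
    fun t _ => pow_lt_one₀ hy hy1 t.size_pos.ne'
  have h2 : ∏ t ∈ insert leaf F, (1 - y ^ t.size)⁻¹ ≤ 1 + C := by
    refine hasSum_le_of_sum_le h1 fun A => ?_
    have h3 : ∃ M, ∀ s ∈ A, ∀ t : Cl, union s.1 = t → t.size ≤ M := by
      refine ⟨∑ s ∈ A, (s.1.map size).sum, fun s hs t ht => ?_⟩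
      rw [← size_union ht]
      exact Finset.single_le_sum (f := fun s => (s.1.map size).sum) (fun _ _ => Nat.zero_le _) hs
    obtain ⟨M, hM⟩ := h3
    refine le_trans ?_ (add_le_add_right (hC M) 1)
    calc _ ≤ ∑ o ∈ insert (0 : WithZero Cl) ((upTo M).image (fun t : Cl => (t : WithZero Cl))),
          (WithZero.recZeroCoe 1 (fun t : Cl => y ^ t.size) o : ℝ) := ?_
      _ = _ := ?_
    · refine sum_le_sum_of_injOn (fun s => union s.1) (fun s hs => ?_)
        (fun s _ s' _ h => Subtype.ext (union_injOn (fun p hp => hU p (s.2 p hp))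
          (fun p hp => hU p (s'.2 p hp)) h)) (fun s hs => ?_) fun o _ => ?_
      · cases h : union s.1 with
        | zero => exact Finset.mem_insert_self _ _
        | coe t =>
          exact Finset.mem_insert_of_mem (Finset.mem_image_of_mem _ (mem_upTo.2 (hM s hs t h)))
      · cases h : union s.1 with
        | zero =>
          have h5 : s.1 = 0 := union_injOn (fun p hp => hU p (s.2 p hp)) (by simp) h
          rw [h5, Multiset.map_zero, Multiset.prod_zero]
          rfl
        | coe t => exact prod_map_pow_size y h
      · induction o using WithZero.recZeroCoe
        · exact zero_le_one
        · exact pow_nonneg hy _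
    · rw [Finset.sum_insert (by simp), Finset.sum_image (by simp)]
      simp [gs]
  rw [Finset.prod_insert hl, size_leaf, pow_one] at h2
  have h4 : Real.exp (gs IsRest N y + gs IsRest N (y ^ 2) / 2 + gs IsRest N (y ^ 3) / 3) ≤
      ∏ t ∈ F, (1 - y ^ t.size)⁻¹ := by
    rw [gs, gs, gs, Finset.sum_div, Finset.sum_div, ← Finset.sum_add_distrib,
      ← Finset.sum_add_distrib, Real.exp_sum, ← hF]
    refine Finset.prod_le_prod (fun _ _ => (Real.exp_pos _).le) fun t _ => ?_
    rw [pow_right_comm y 2, pow_right_comm y 3]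
    exact exp_le_inv_one_sub (pow_nonneg hy _) (pow_lt_one₀ hy hy1 t.size_pos.ne')
  rw [inv_mul_le_iff₀ (by linarith)] at h2
  exact h4.trans h2

end Cl

end DistHered

namespace DistHered

namespace Cl

open Filter Topology

/-- The relations between the generating functions of all classes, of the disjoint unions, of the
nontrivial classes which are not disjoint unions, and of the attachments. -/
structure GenFun (y T U P X : ℝ) : Prop where
  pos : 0 < y
  lt_one : y < 1
  le (N : ℕ) : gs (fun _ => True) N y ≤ T
  tendsto : Tendsto (fun N => gs IsRest N y) atTop (𝓝 P)
  le_add : T ≤ y + P + U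
  mul_le : (y + 2 * U) * (1 + T) ≤ T
  sq_le : T ^ 2 ≤ X * (1 + T)
  add_le : U + X ≤ P

theorem exists_tendsto_gs {y C : ℝ} (hy : 0 ≤ y) (hC : ∀ N, gs (fun _ => True) N y ≤ C)
    (p : Cl → Prop) :
    ∃ l, (∀ N, gs p N y ≤ l) ∧ Tendsto (fun N => gs p N y) atTop (𝓝 l) := by
  have hb : BddAbove (Set.range fun N => gs p N y) := by
    refine ⟨C, ?_⟩
    rintro _ ⟨N, rfl⟩
    exact (gs_le_gs hy fun _ _ => trivial).trans (hC N)
  exact ⟨⨆ N, gs p N y, le_ciSup hb, tendsto_atTop_ciSup (fun _ _ h => gs_mono hy h) hb⟩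

theorem exists_genFun {y C : ℝ} (hy : 0 < y) (hy1 : y < 1)
    (hC : ∀ N, gs (fun _ => True) N y ≤ C) : ∃ T U P X, GenFun y T U P X := by
  obtain ⟨T, hT, hT'⟩ := exists_tendsto_gs hy.le hC fun _ => True
  obtain ⟨U, -, hU⟩ := exists_tendsto_gs hy.le hC (IsOp .U)
  obtain ⟨P, -, hP⟩ := exists_tendsto_gs hy.le hC IsRest
  obtain ⟨X, hX, hX'⟩ := exists_tendsto_gs hy.le hC (IsOp .X)
  have hmul : ∀ N, gs (fun t => ¬ t.IsOp .X) N y * gs (fun _ => True) N y ≤ X := fun N =>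
    (mul_gs_le hy.le fun _ h => h).trans (hX _)
  have hU0 : ∀ N, 1 ≤ N → y + 2 * gs (IsOp .U) N y ≤ gs (fun t => ¬ t.IsOp .X) N y := by
    intro N hN
    have h1 := le_gs_leaf (y := y) hN
    have h2 := gs_union_le (N := N) hy.le
    have h3 : gs (IsOp .U) N y + gs (IsOp .K) N y ≤ gs (fun t => t.IsOp .U ∨ t.IsOp .K) N y :=
      add_gs_le hy.le (fun _ => .inl) (fun _ => .inr) fun t h h' => nomatch h.unique h'
    have h4 : gs (· = leaf) N y + gs (fun t => t.IsOp .U ∨ t.IsOp .K) N y ≤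
        gs (fun t => ¬ t.IsOp .X) N y := by
      refine add_gs_le hy.le (fun t h => h ▸ not_isOp_leaf _) (fun t h hX => ?_) fun t h h' => ?_
      · rcases h with h | h <;> exact nomatch h.unique hX
      · subst h
        rcases h' with h | h <;> exact not_isOp_leaf _ h
    linarith
  have hX1 : ∀ N, gs (fun t => ¬ t.IsOp .X) N y + gs (IsOp .X) N y ≤ gs (fun _ => True) N y :=
    fun N => add_gs_le hy.le (fun _ _ => trivial) (fun _ _ => trivial) fun _ h => h
  have hX2 : ∀ N, gs (fun _ => True) N y ≤ gs (fun t => ¬ t.IsOp .X) N y + gs (IsOp .X) N y :=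
    fun N => gs_le_add hy.le fun _ _ => (em _).symm
  refine ⟨T, U, P, X, hy, hy1, hT, hP, ?_, ?_, ?_, ?_⟩
  · refine le_of_tendsto_of_tendsto' hT' ((hP.const_add y).add hU) fun N =>
      gs_le_add_rest_add_union hy.le
  · have h1 : (y + 2 * U) * T ≤ X := by
      refine le_of_tendsto (((hU.const_mul 2).const_add y).mul hT') ?_
      filter_upwards [eventually_ge_atTop 1] with N hN
      exact (mul_le_mul_of_nonneg_right (hU0 N hN) (gs_nonneg hy.le)).trans (hmul N)
    have h2 : y + 2 * U + X ≤ T := by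
      refine le_of_tendsto_of_tendsto (((hU.const_mul 2).const_add y).add hX') hT' ?_
      filter_upwards [eventually_ge_atTop 1] with N hN
      exact (add_le_add_left (hU0 N hN) _).trans (hX1 N)
    linarith
  · have h1 : (T - X) * T ≤ X := by
      refine le_of_tendsto' ((hT'.sub hX').mul hT') fun N => ?_
      have h2 := hX2 N
      exact (mul_le_mul_of_nonneg_right (by linarith) (gs_nonneg hy.le)).trans (hmul N)
    linarith
  · refine le_of_tendsto_of_tendsto' (hU.add hX') hP fun N => ?_
    have h1 : gs (IsOp .K) N y + gs (IsOp .X) N y ≤ gs IsRest N y := by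
      refine add_gs_le hy.le (fun t h => ⟨fun h' => (nomatch h.unique h'), ?_⟩)
        (fun t h => ⟨fun h' => (nomatch h.unique h'), ?_⟩) fun t h h' => nomatch h.unique h'
      all_goals
        rintro rfl
        exact not_isOp_leaf _ h
    have h2 := gs_union_le (N := N) hy.le
    linarith

namespace GenFun

variable {y T U P X : ℝ}

theorem le_right (h : GenFun y T U P X) : y ≤ T :=
  ((le_gs_leaf le_rfl).trans (gs_le_gs h.pos.le fun _ _ => trivial)).trans (h.le 1)

theorem nonneg (h : GenFun y T U P X) : 0 ≤ P :=
  ge_of_tendsto' h.tendsto fun _ => gs_nonneg h.pos.le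

theorem exp_le (h : GenFun y T U P X) {T' U' P' X' T'' U'' P'' X'' : ℝ}
    (h' : GenFun (y ^ 2) T' U' P' X') (h'' : GenFun (y ^ 3) T'' U'' P'' X'') :
    Real.exp (P + P' / 2 + P'' / 3) ≤ (1 - y) * (1 + T) :=
  le_of_tendsto' ((Real.continuous_exp.tendsto _).comp ((h.tendsto.add (h'.tendsto.div_const 2)).add
    (h''.tendsto.div_const 3))) fun _ => exp_gs_le h.pos.le h.lt_one h.le

theorem one_add_le (h : GenFun y T U P X) : 1 + P ≤ (1 - y) * (1 + T) := by
  refine le_of_tendsto' (h.tendsto.const_add 1) fun N =>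
    le_trans ?_ (exp_gs_le (N := N) h.pos.le h.lt_one h.le)
  have h1 := Real.add_one_le_exp
    (gs IsRest N y + gs IsRest N (y ^ 2) / 2 + gs IsRest N (y ^ 3) / 3)
  have h2 : 0 ≤ gs IsRest N (y ^ 2) := gs_nonneg (pow_nonneg h.pos.le _)
  have h3 : 0 ≤ gs IsRest N (y ^ 3) := gs_nonneg (pow_nonneg h.pos.le _)
  linarith

theorem le_total {p : ℝ} (h : GenFun y T U P X) (hp0 : 0 ≤ p) (hp : p ≤ P) :
    y + y ^ 2 + y ^ 3 + p * (1 + y) ≤ T := by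
  have h1 := h.one_add_le
  have h2 := h.pos
  have h3 := h.lt_one
  have h4 : (1 - y) * (y + y ^ 2 + y ^ 3 + p * (1 + y)) ≤ (1 - y) * T := by
    have h5 : 0 ≤ y ^ 4 := by positivity
    have h6 : 0 ≤ p * y ^ 2 := by positivity
    nlinarith
  exact le_of_mul_le_mul_left h4 (by linarith)

theorem le_rest {t s p : ℝ} (h : GenFun y T U P X) (ht0 : 0 ≤ t) (ht : t ≤ T)
    (hs : s * (1 + t) ≤ t ^ 2) (hp : p * (1 - y) ≤ y ^ 2 + y ^ 3 + s) : p ≤ P := by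
  have h1 := h.sq_le
  have h2 : s ≤ X := by
    have h3 : s * (1 + t) * (1 + T) ≤ X * (1 + T) * (1 + t) := by
      have h4 : t ^ 2 * (1 + T) ≤ T ^ 2 * (1 + t) := by
        have h5 : 0 ≤ (T - t) * (T + t + T * t) :=
          mul_nonneg (by linarith) (by nlinarith)
        nlinarith
      have h5 := mul_le_mul_of_nonneg_right hs (show 0 ≤ 1 + T by linarith)
      have h6 := mul_le_mul_of_nonneg_right h1 (show 0 ≤ 1 + t by linarith)
      linarith
    have h7 : 0 < (1 + t) * (1 + T) := mul_pos (by linarith) (by linarith)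
    exact le_of_mul_le_mul_right (by linarith) h7
  have h8 := h.le_total h.nonneg le_rfl
  have h9 := h.le_add
  have h10 := h.add_le
  have h11 : p * (1 - y) ≤ P * (1 - y) := by linarith
  exact le_of_mul_le_mul_right h11 (by linarith [h.lt_one])

end GenFun

end Cl

end DistHered

namespace DistHered

namespace Cl

theorem lt_exp_of_taylor {v r : ℝ} (h0 : 0 ≤ v)
    (h : r < 1 + v + v ^ 2 / 2 + v ^ 3 / 6 + v ^ 4 / 24 + v ^ 5 / 120) : r < Real.exp v := by
  refine h.trans_le (le_trans (le_of_eq ?_) (Real.sum_le_exp_of_nonneg h0 6))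
  norm_num [Finset.sum_range_succ, Nat.factorial]

theorem GenFun.false_of_exp_lt {x T U P X L m a z : ℝ} (h : GenFun x T U P X)
    (hL : Real.exp (P + L) ≤ (1 - x) * (1 + T)) (hz : 0 < z) (hm : m ^ 2 ≤ 2 * a)
    (ha : a = 1 - 1 / z) (hv : (1 - x) * z < Real.exp (m - 1 / 2 - x / 2 + L)) : False := by
  have hx := h.lt_one
  have hx0 := h.pos
  have hT : 0 < 1 + T := by linarith [h.le_right]
  have h1 : x + 2 * U ≤ 1 - 1 / (1 + T) := by
    rw [one_sub_div hT.ne', le_div_iff₀ hT]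
    linarith [h.mul_le]
  have h2 := h.le_add
  have h3 : m ≤ a * (1 + T) + 1 / 2 * (1 / (1 + T)) := by
    have h4 : a * (1 + T) + 1 / 2 * (1 / (1 + T)) = (a * (1 + T) ^ 2 + 1 / 2) / (1 + T) := by
      field_simp
    rw [h4, le_div_iff₀ hT]
    nlinarith [sq_nonneg (m * (1 + T) - 1), mul_le_mul_of_nonneg_right hm (sq_nonneg (1 + T))]
  have h5 : Real.exp (P + L - ((1 + T) / z - 1)) ≤ (1 - x) * z := by
    rw [Real.exp_sub, div_le_iff₀ (Real.exp_pos _)]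
    refine hL.trans ?_
    have h6 := Real.add_one_le_exp ((1 + T) / z - 1)
    rw [sub_add_cancel, div_le_iff₀ hz] at h6
    have h7 := mul_le_mul_of_nonneg_left h6 (show 0 ≤ 1 - x by linarith)
    linarith
  have h8 : m - 1 / 2 - x / 2 + L ≤ P + L - ((1 + T) / z - 1) := by
    rw [ha, sub_mul, one_mul, div_mul_eq_mul_div, one_mul] at h3
    linarith
  exact absurd ((Real.exp_le_exp.2 h8).trans h5) (not_le.2 hv)

/-- The generating function of all classes diverges slightly outside of its disc of convergence. -/
theorem not_bounded_gs (C : ℝ) : ¬ ∀ N, gs (fun _ => True) N (10000 / 72491) ≤ C := by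
  intro hC
  obtain ⟨x, hx⟩ : ∃ x : ℝ, x = 10000 / 72491 := ⟨_, rfl⟩
  rw [← hx] at hC
  have hx0 : 0 < x := by norm_num [hx]
  have hx1 : x < 1 := by norm_num [hx]
  have hb : ∀ k : ℕ, k ≠ 0 → ∃ T U P X, GenFun (x ^ k) T U P X := fun k hk =>
    exists_genFun (by positivity) (pow_lt_one₀ hx0.le hx1 hk) fun N =>
      (gs_le_gs_left (by positivity) (pow_le_of_le_one hx0.le hx1.le hk)).trans (hC N)
  obtain ⟨T, U, P, X, h⟩ := exists_genFun hx0 hx1 hC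
  obtain ⟨T₂, U₂, P₂, X₂, h₂⟩ := hb 2 two_ne_zero
  obtain ⟨T₃, U₃, P₃, X₃, h₃⟩ := hb 3 three_ne_zero
  have hP₂ : 0.000782 ≤ P₂ := by
    have h1 := h₂.le_total le_rfl h₂.nonneg
    have h2 := h₂.le_rest (t := 0.019398715) (s := 0.0003691491) (p := 0.0007524892)
      (by norm_num) (le_trans (by norm_num [hx]) h1) (by norm_num) (by norm_num [hx])
    have h3 := h₂.le_total (by norm_num) h2
    exact h₂.le_rest (t := 0.0201655) (s := 0.0003986) (by norm_num)
      (le_trans (by norm_num [hx]) h3) (by norm_num) (by norm_num [hx])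
  have hP₃ : 0.000013855 ≤ P₃ := by
    have h1 := h₃.le_total le_rfl h₃.nonneg
    exact h₃.le_rest (t := 0.00263202063) (s := 0.0000069093465) (by norm_num)
      (le_trans (by norm_num [hx]) h1) (by norm_num) (by norm_num [hx])
  refine h.false_of_exp_lt (L := 0.000782 / 2 + 0.000013855 / 3) (m := 0.7320508)
    (z := 1.3660254) ((Real.exp_le_exp.2 ?_).trans (h.exp_le h₂ h₃)) (by norm_num) ?_ rfl
    (lt_exp_of_taylor ?_ ?_)
  · linarith
  all_goals norm_num [hx]

end Cl

end DistHered

namespace DistHered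

namespace Cl

theorem union_leaf_injective : Function.Injective (node .U leaf) := fun a b h => by
  have key : ∀ t : Cl, (∀ p ∈ leaf ::ₘ t.components, ¬ p.IsOp .U) ∧
      union (leaf ::ₘ t.components) = node .U leaf t := fun t => by
    refine ⟨fun p hp => ?_, ?_⟩
    · rcases Multiset.mem_cons.1 hp with rfl | hp
      · exact not_isOp_leaf _
      · exact not_isOp_union_of_mem_components hp
    · rw [union_cons, union_components]
      rfl
  have h1 := union_injOn (key a).1 (key b).1 (by rw [(key a).2, (key b).2, h])
  exact components_injective ((Multiset.cons_inj_right _).1 h1)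

/-- The numbers of classes are supermultiplicative. -/
theorem card_ofSize_mul_card_ofSize_le (i j : ℕ) :
    (ofSize i).card * (ofSize j).card ≤ (ofSize (i + (j + 1))).card := by
  rw [← Finset.card_product]
  refine Finset.card_le_card_of_injOn (fun x => node .X (node .U leaf x.1) x.2) (fun x hx => ?_)
    fun x _ y _ h => ?_
  · obtain ⟨h1, h2⟩ := Finset.mem_product.1 hx
    refine mem_ofSize.2 ?_
    rw [size_node, size_node, mem_ofSize.1 h1, mem_ofSize.1 h2, size_leaf]
    omega
  · obtain ⟨h1, h2⟩ := attach_injective (not_isOp_attach_node (c := .U) nofun _ _)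
      (not_isOp_attach_node (c := .U) nofun _ _) h
    exact Prod.ext (union_leaf_injective h1) h2

theorem card_ofSize_pos (n : ℕ) : 0 < (ofSize (n + 1)).card := by
  rw [Finset.card_pos]
  induction n with
  | zero => exact ⟨leaf, mem_ofSize.2 rfl⟩
  | succ n ih =>
    obtain ⟨t, ht⟩ := ih
    exact ⟨node .U t leaf, mem_ofSize.2 (by rw [size_node, mem_ofSize.1 ht, size_leaf])⟩

theorem pow_card_ofSize_le (m r q : ℕ) :
    (ofSize m).card ^ q ≤ (ofSize (r + 1 + q * (m + 1))).card := by
  induction q with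
  | zero =>
    rw [pow_zero, zero_mul]
    exact card_ofSize_pos r
  | succ q ih =>
    rw [pow_succ, add_mul, one_mul, ← add_assoc]
    exact (Nat.mul_le_mul_right _ ih).trans (card_ofSize_mul_card_ofSize_le _ _)

theorem gs_le_sum {p : Cl → Prop} {y : ℝ} (hy : 0 ≤ y) (N : ℕ) :
    gs p N y ≤ ∑ m ∈ Finset.range (N + 1), (ofSize m).card * y ^ m := by
  classical
  rw [gs, ← Finset.sum_fiberwise_of_maps_to (g := size) (t := Finset.range (N + 1))]
  · refine Finset.sum_le_sum fun m _ => ?_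
    rw [← nsmul_eq_mul, ← Finset.sum_const]
    refine (Finset.sum_congr rfl fun t ht => ?_).trans_le
      (Finset.sum_le_sum_of_subset_of_nonneg (fun t ht => ?_) fun t _ _ => pow_nonneg hy _)
    · rw [(Finset.mem_filter.1 ht).2]
    · exact mem_ofSize.2 (Finset.mem_filter.1 ht).2
  · intro t ht
    exact Finset.mem_range_succ_iff.2 (mem_upTo.1 (Finset.mem_filter.1 ht).1)

theorem exists_lt_card_ofSize : ∃ m, (7.24905 : ℝ) ^ (m + 1) < (ofSize m).card := by
  by_contra! h
  refine not_bounded_gs (7.24905 * (1 - 7.24905 * (10000 / 72491))⁻¹) fun N =>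
    (gs_le_sum (by norm_num) N).trans ?_
  calc _ ≤ ∑ m ∈ Finset.range (N + 1), (7.24905 * (7.24905 * (10000 / 72491)) ^ m : ℝ) := by
        refine Finset.sum_le_sum fun m _ => ?_
        rw [mul_pow, ← mul_assoc, ← pow_succ']
        exact mul_le_mul_of_nonneg_right (h m) (by positivity)
    _ ≤ _ := by
        rw [← Finset.mul_sum]
        refine mul_le_mul_of_nonneg_left ?_ (by norm_num)
        exact sum_le_hasSum _ (fun _ _ => by positivity)
          (hasSum_geometric_of_lt_one (by norm_num) (by norm_num))

open Filter Topology in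
theorem eventually_le_numConnDH : ∀ᶠ n in atTop, (7.249 : ℝ) ^ n ≤ numConnDH n := by
  obtain ⟨m, hm⟩ := exists_lt_card_ofSize
  have h1 := tendsto_self_mul_const_pow_of_lt_one (r := 7.249 / 7.24905) (by norm_num)
    (by norm_num)
  have h2 : (0 : ℝ) < (7.24905 ^ (m + 2))⁻¹ := by positivity
  filter_upwards [h1.eventually (eventually_le_nhds h2), eventually_ge_atTop 2] with n hn hn2
  obtain ⟨k, rfl⟩ : ∃ k, n = k + 2 := ⟨n - 2, by omega⟩
  have h3 := pow_card_ofSize_le m (k % (m + 1)) (k / (m + 1))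
  have h4 : k % (m + 1) + 1 + k / (m + 1) * (m + 1) = k + 1 := by
    have := Nat.mod_add_div k (m + 1)
    rw [mul_comm] at this
    omega
  rw [h4] at h3
  have h5 : ((ofSize (k + 1)).card : ℝ) ≤ numConnDH (k + 2) * ((k + 2 : ℕ) : ℝ) := by
    exact_mod_cast card_ofSize_le (k + 1)
  have h6 : (7.24905 : ℝ) ^ ((m + 1) * (k / (m + 1))) ≤ (ofSize (k + 1)).card := by
    rw [pow_mul]
    exact (pow_le_pow_left₀ (by positivity) hm.le _).trans (by exact_mod_cast h3)
  have h7 : (7.24905 : ℝ) ^ (k + 2) ≤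
      7.24905 ^ (m + 2) * 7.24905 ^ ((m + 1) * (k / (m + 1))) := by
    rw [← pow_add]
    refine pow_le_pow_right₀ (by norm_num) ?_
    have := Nat.mod_add_div k (m + 1)
    have := Nat.mod_lt k (show 0 < m + 1 by omega)
    omega
  have h8 : ((k + 2 : ℕ) : ℝ) * 7.249 ^ (k + 2) ≤
      (7.24905 ^ (m + 2))⁻¹ * 7.24905 ^ (k + 2) := by
    rw [div_pow, ← mul_div_assoc, div_le_iff₀ (by positivity)] at hn
    exact hn
  have h9 : ((7.24905 : ℝ) ^ (m + 2))⁻¹ * 7.24905 ^ (k + 2) ≤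
      7.24905 ^ ((m + 1) * (k / (m + 1))) := by
    rwa [inv_mul_le_iff₀ (by positivity)]
  have h10 : ((k + 2 : ℕ) : ℝ) * 7.249 ^ (k + 2) ≤ ((k + 2 : ℕ) : ℝ) * numConnDH (k + 2) := by
    linarith
  exact le_of_mul_le_mul_left h10 (by positivity)

theorem numConnDH_le_pow {n : ℕ} (hn : 2 ≤ n) : (numConnDH n : ℝ) ≤ 7.2498 ^ n := by
  obtain ⟨k, rfl⟩ : ∃ k, n = k + 1 := ⟨n - 1, by omega⟩
  calc (numConnDH (k + 1) : ℝ) ≤ (ofSize k).card := by exact_mod_cast numConnDH_le (by omega)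
    _ ≤ 7.2498 ^ k := card_ofSize_le_pow k
    _ ≤ 7.2498 ^ (k + 1) := pow_le_pow_right₀ (by norm_num) k.le_succ

end Cl

end DistHered

theorem numConnDH_growth_rate :
    ∃ N : ℕ, ∀ n : ℕ, N ≤ n →
      (7.249 : ℝ) ^ n ≤ (numConnDH n : ℝ) ∧ (numConnDH n : ℝ) ≤ (7.2498 : ℝ) ^ n := by
  obtain ⟨N, hN⟩ := Filter.eventually_atTop.1 DistHered.Cl.eventually_le_numConnDH
  exact ⟨max N 2, fun n hn => ⟨hN n ((le_max_left _ _).trans hn),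
    DistHered.Cl.numConnDH_le_pow ((le_max_right _ _).trans hn)⟩⟩
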